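/- arXiv:2002.10814 — 2 statements merged into one kernel-verified Lean document; each statement's English description precedes it below -/
import Mathlib

section
/- The rooted partial failure trace preorder is the largest precongruence for the operators of CCSP_t that is included in the partial failure trace preorder; equivalently, for all processes P and Q: rfft(P) ⊇ rfft(Q) if and only if fft(C[P]) ⊇ fft(C[Q]) for every unary recursion-free CCSP_t-context C. -/
/-! ### The process algebra CCSP_t

The countably infinite set `A` of visible actions and the countably infinite set `V`
of variables are both taken to be `ℕ`. -/

/-- Actions: visible actions from `A = ℕ`, the hidden action `τ`,
and the time-out action `t`. -/
inductive Act : Type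
  | act : ℕ → Act
  | tau : Act
  | timeout : Act

/-- CCSP_t expressions.  A recursive specification `S` is represented as a partial
function `ℕ → Option Expr`; its domain is the set `V_S` of bound variables, and
`⟨X|S⟩` is written `Expr.fix X S`. -/
inductive Expr : Type
  | nil : Expr
  | pre : Act → Expr → Expr
  | choice : Expr → Expr → Expr
  | par : Set ℕ → Expr → Expr → Expr
  | abs : Set ℕ → Expr → Expr
  | ren : Set (ℕ × ℕ) → Expr → Expr
  | var : ℕ → Expr
  | fix : ℕ → (ℕ → Option Expr) → Expr

/-- `α.notIn S`: the action `α` is not a visible action belonging to `S ⊆ A`. -/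
def Act.notIn (α : Act) (S : Set ℕ) : Prop := ∀ a : ℕ, α = Act.act a → a ∉ S

/-- Relational substitution: `Subst ρ E E'` holds iff `E'` is the result of replacing,
in `E`, every free occurrence of each variable `Y` in the domain of `ρ` by the
expression `ρ Y` (occurrences bound by an inner recursion are not replaced). -/
inductive Subst : (ℕ → Option Expr) → Expr → Expr → Prop
  | nil {ρ} : Subst ρ .nil .nil
  | pre {ρ α E E'} : Subst ρ E E' → Subst ρ (.pre α E) (.pre α E')
  | choice {ρ E F E' F'} : Subst ρ E E' → Subst ρ F F' →
      Subst ρ (.choice E F) (.choice E' F')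
  | par {ρ S E F E' F'} : Subst ρ E E' → Subst ρ F F' →
      Subst ρ (.par S E F) (.par S E' F')
  | abs {ρ I E E'} : Subst ρ E E' → Subst ρ (.abs I E) (.abs I E')
  | ren {ρ R E E'} : Subst ρ E E' → Subst ρ (.ren R E) (.ren R E')
  | varNone {ρ Y} : ρ Y = none → Subst ρ (.var Y) (.var Y)
  | varSome {ρ Y F} : ρ Y = some F → Subst ρ (.var Y) F
  | fix {ρ Z} {T T' : ℕ → Option Expr} :
      (∀ Y, T Y = none ↔ T' Y = none) →
      (∀ Y E E', T Y = some E → T' Y = some E' →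
          Subst (fun W => if (T W).isSome then none else ρ W) E E') →
      Subst ρ (.fix Z T) (.fix Z T')

/-- The substitution replacing each bound variable `Y` of `S` by `⟨Y|S⟩`. -/
def recmap (S : ℕ → Option Expr) : ℕ → Option Expr :=
  fun Y => (S Y).map (fun _ => Expr.fix Y S)

/-- The structural operational (interleaving) semantics of CCSP_t. -/
inductive Step : Expr → Act → Expr → Prop
  | pre {α E} : Step (.pre α E) α E
  | choiceL {E F α E'} : Step E α E' → Step (.choice E F) α E'
  | choiceR {E F α F'} : Step F α F' → Step (.choice E F) α F'
  | renTau {R E E'} : Step E .tau E' → Step (.ren R E) .tau (.ren R E')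
  | renTimeout {R E E'} : Step E .timeout E' →
      Step (.ren R E) .timeout (.ren R E')
  | renAct {R E E' a b} : Step E (.act a) E' → (a, b) ∈ R →
      Step (.ren R E) (.act b) (.ren R E')
  | parL {S E F α E'} : Step E α E' → α.notIn S →
      Step (.par S E F) α (.par S E' F)
  | parR {S E F α F'} : Step F α F' → α.notIn S →
      Step (.par S E F) α (.par S E F')
  | parSync {S E F a E' F'} : Step E (.act a) E' → Step F (.act a) F' → a ∈ S →
      Step (.par S E F) (.act a) (.par S E' F')
  | absFree {I E α E'} : Step E α E' → α.notIn I →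
      Step (.abs I E) α (.abs I E')
  | absHide {I E a E'} : Step E (.act a) E' → a ∈ I →
      Step (.abs I E) .tau (.abs I E')
  | fixUnfold {X S E E' α F} : S X = some E → Subst (recmap S) E E' →
      Step E' α F → Step (.fix X S) α F

/-- Free occurrence of a variable in a CCSP_t expression. -/
inductive Free (x : ℕ) : Expr → Prop
  | pre {α E} : Free x E → Free x (.pre α E)
  | choiceL {E F} : Free x E → Free x (.choice E F)
  | choiceR {E F} : Free x F → Free x (.choice E F)
  | parL {S E F} : Free x E → Free x (.par S E F)
  | parR {S E F} : Free x F → Free x (.par S E F)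
  | abs {I E} : Free x E → Free x (.abs I E)
  | ren {R E} : Free x E → Free x (.ren R E)
  | var : Free x (.var x)
  | fix {Z T Y E} : T Y = some E → Free x E → T x = none → Free x (.fix Z T)

/-- An expression is closed if no variable occurs free in it. -/
def Closed (E : Expr) : Prop := ∀ x, ¬ Free x E

/-- Well-formedness: in every recursion `⟨X|S⟩` occurring in the expression the
variable `X` is bound by `S`, and every relational renaming occurring in it has
finite images `{b | (a,b) ∈ R}`. -/
inductive WF : Expr → Prop
  | nil : WF .nil
  | pre {α E} : WF E → WF (.pre α E)
  | choice {E F} : WF E → WF F → WF (.choice E F)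
  | par {S E F} : WF E → WF F → WF (.par S E F)
  | abs {I E} : WF E → WF (.abs I E)
  | ren {R E} : (∀ a : ℕ, {b | (a, b) ∈ R}.Finite) → WF E → WF (.ren R E)
  | var {X} : WF (.var X)
  | fix {X T} : (T X).isSome → (∀ Y E, T Y = some E → WF E) → WF (.fix X T)

/-- `ℙ`: a process is a closed well-formed CCSP_t expression. -/
def IsProcess (E : Expr) : Prop := Closed E ∧ WF E

/-- A process is stable if it has no outgoing τ-transitions. -/
def stable (P : Expr) : Prop := ¬ ∃ P', Step P .tau P'

/-- The set `I(P)` of initial visible actions of a process. -/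
def initials (P : Expr) : Set ℕ := {a | ∃ P', Step P (.act a) P'}

/-! ### Partial failure traces -/

/-- An element of a partial failure trace: a visible action `a ∈ A`
or a refusal set `X ⊆ A`. -/
abbrev Elt : Type := Sum ℕ (Set ℕ)

/-- Partial failure traces: sequences over `A ∪ 𝒫(A)`; the final tag `⊤` is
left implicit. -/
abbrev PFT : Type := List Elt

/-- The set of partial failure traces of a process (Table 3). -/
inductive fft : Expr → PFT → Prop
  | top {P} : fft P []
  | act {P Q a ρ} : Step P (.act a) Q → fft Q ρ → fft P (Sum.inl a :: ρ)
  | tau {P Q ρ} : Step P .tau Q → fft Q ρ → fft P ρ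
  | refusal {P X ρ} : (∀ a ∈ X, a ∉ initials P) → stable P → fft P ρ →
      fft P (Sum.inr X :: ρ)
  | timeoutRef {P Q X ρ} : (∀ a ∈ X, a ∉ initials P) → stable P →
      Step P .timeout Q → fft Q (Sum.inr X :: ρ) → fft P (Sum.inr X :: ρ)
  | timeoutAct {P Q X a ρ} : (∀ a' ∈ X, a' ∉ initials P) → stable P →
      Step P .timeout Q → fft Q (Sum.inl a :: ρ) → a ∈ X →
      fft P (Sum.inr X :: Sum.inl a :: ρ)

def fftSet (P : Expr) : Set PFT := {σ | fft P σ}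

/-! ### Rooted partial failure traces -/

/-- Rooted partial failure traces: ordinary partial failure traces, traces
`t·Xσ` starting with a time-out transition (represented as `rooted X σ`,
standing for the trace `Xσ` preceded by `t`), and the two tags `st`
and `post-st`. -/
inductive RPFT : Type
  | plain : PFT → RPFT
  | rooted : Set ℕ → PFT → RPFT
  | st : RPFT
  | postst : RPFT

/-- The set `rfft(P)` of rooted partial failure traces of a process. -/
def rfftSet (P : Expr) : Set RPFT :=
  {r |
    (∃ σ, r = RPFT.plain σ ∧ fft P σ) ∨
    (r = RPFT.st ∧ stable P) ∨
    (∃ X σ, r = RPFT.rooted X σ ∧ stable P ∧ (∀ a ∈ X, a ∉ initials P) ∧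
      ∃ P', Step P .timeout P' ∧ fft P' (Sum.inr X :: σ)) ∨
    (r = RPFT.postst ∧ (∃ P', Step P .tau P') ∧ fft P [Sum.inr (∅ : Set ℕ)])}

/-! ### Unary recursion-free CCSP_t-contexts -/

/-- Unary recursion-free CCSP_t-contexts: expressions built from a hole and the
operators of CCSP_t, with expressions as further arguments. -/
inductive Ctx : Type
  | hole : Ctx
  | pre : Act → Ctx → Ctx
  | choiceL : Ctx → Expr → Ctx
  | choiceR : Expr → Ctx → Ctx
  | parL : Set ℕ → Ctx → Expr → Ctx
  | parR : Set ℕ → Expr → Ctx → Ctx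
  | abs : Set ℕ → Ctx → Ctx
  | ren : Set (ℕ × ℕ) → Ctx → Ctx

/-- `C.fill P = C[P]`: the process obtained by filling the hole with `P`. -/
def Ctx.fill : Ctx → Expr → Expr
  | .hole, P => P
  | .pre α C, P => .pre α (C.fill P)
  | .choiceL C Q, P => .choice (C.fill P) Q
  | .choiceR Q C, P => .choice Q (C.fill P)
  | .parL S C Q, P => .par S (C.fill P) Q
  | .parR S Q C, P => .par S Q (C.fill P)
  | .abs I C, P => .abs I (C.fill P)
  | .ren R C, P => .ren R (C.fill P)

/-- The further arguments of the context are closed processes, and all renaming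
operators in the context have finite images. -/
inductive Ctx.OK : Ctx → Prop
  | hole : Ctx.OK .hole
  | pre {α C} : Ctx.OK C → Ctx.OK (.pre α C)
  | choiceL {C Q} : Ctx.OK C → IsProcess Q → Ctx.OK (.choiceL C Q)
  | choiceR {Q C} : IsProcess Q → Ctx.OK C → Ctx.OK (.choiceR Q C)
  | parL {S C Q} : Ctx.OK C → IsProcess Q → Ctx.OK (.parL S C Q)
  | parR {S Q C} : IsProcess Q → Ctx.OK C → Ctx.OK (.parR S Q C)
  | abs {I C} : Ctx.OK C → Ctx.OK (.abs I C)
  | ren {R C} : (∀ a : ℕ, {b | (a, b) ∈ R}.Finite) → Ctx.OK C → Ctx.OK (.ren R C)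

/-! ### Inversion of partial failure traces -/

/-- `P` is stable and refuses all visible actions in `X`. -/
def Refuses (P : Expr) (X : Set ℕ) : Prop := stable P ∧ ∀ a ∈ X, a ∉ initials P

theorem Refuses.mono {P : Expr} {X Y : Set ℕ} (h : Refuses P X) (hY : Y ⊆ X) : Refuses P Y :=
  ⟨h.1, fun a ha => h.2 a (hY ha)⟩

theorem fft_act_inv {P : Expr} {a : ℕ} {σ : PFT} (hP : stable P) (h : fft P (Sum.inl a :: σ)) :
    ∃ P', Step P (.act a) P' ∧ fft P' σ := by
  cases h with
  | act hs hf => exact ⟨_, hs, hf⟩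
  | tau hs _ => exact (hP ⟨_, hs⟩).elim

theorem Refuses.not_fft_act {P : Expr} {Y : Set ℕ} {a : ℕ} {σ : PFT} (h : Refuses P Y)
    (ha : a ∈ Y) : ¬ fft P (Sum.inl a :: σ) := fun hf => by
  obtain ⟨P', hs, -⟩ := fft_act_inv h.1 hf
  exact h.2 a ha ⟨P', hs⟩

theorem refuses_of_stable {P : Expr} {X : Set ℕ} {σ : PFT} (hP : stable P)
    (h : fft P (Sum.inr X :: σ)) : Refuses P X := by
  cases h with
  | tau hs _ => exact (hP ⟨_, hs⟩).elim
  | refusal h1 h2 _ => exact ⟨h2, h1⟩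
  | timeoutRef h1 h2 _ _ => exact ⟨h2, h1⟩
  | timeoutAct h1 h2 _ _ _ => exact ⟨h2, h1⟩

theorem fft_refusal_tau {P : Expr} {X : Set ℕ} {σ : PFT} (hP : ¬ stable P)
    (h : fft P (Sum.inr X :: σ)) : ∃ P', Step P .tau P' ∧ fft P' (Sum.inr X :: σ) := by
  cases h with
  | tau hs hf => exact ⟨_, hs, hf⟩
  | refusal _ h2 _ => exact (hP h2).elim
  | timeoutRef _ h2 _ _ => exact (hP h2).elim
  | timeoutAct _ h2 _ _ _ => exact (hP h2).elim

/-- A state refusing `X` also refuses each subset of `X`, before continuing with the trace. -/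
theorem fft_refusal_cons {P : Expr} {X Y : Set ℕ} {σ : PFT} (hY : Y ⊆ X)
    (h : fft P (Sum.inr X :: σ)) : fft P (Sum.inr Y :: Sum.inr X :: σ) := by
  generalize hσ : (Sum.inr X :: σ : PFT) = ρ at h
  induction h with
  | top => simp at hσ
  | act => simp at hσ
  | tau hs _ ih => exact .tau hs (ih hσ)
  | refusal h1 h2 h3 _ =>
    obtain ⟨h, rfl⟩ := List.cons.inj hσ
    cases h
    exact .refusal (fun a ha => h1 a (hY ha)) h2 (.refusal h1 h2 h3)
  | timeoutRef h1 h2 h3 h4 _ =>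
    obtain ⟨h, rfl⟩ := List.cons.inj hσ
    cases h
    exact .refusal (fun a ha => h1 a (hY ha)) h2 (.timeoutRef h1 h2 h3 h4)
  | timeoutAct h1 h2 h3 h4 h5 _ =>
    obtain ⟨h, rfl⟩ := List.cons.inj hσ
    cases h
    exact .refusal (fun a ha => h1 a (hY ha)) h2 (.timeoutAct h1 h2 h3 h4 h5)

theorem fft_of_append {P : Expr} {σ ρ : PFT} (h : fft P (σ ++ ρ)) : fft P σ := by
  generalize hσ : σ ++ ρ = π at h
  induction h generalizing σ with
  | top => simp_all [fft.top]
  | act hs _ ih =>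
    rcases List.append_eq_cons_iff.1 hσ with ⟨rfl, _⟩ | ⟨σ', rfl, h⟩
    · exact .top
    · exact .act hs (ih h.symm)
  | tau hs _ ih => exact .tau hs (ih hσ)
  | refusal h1 h2 _ ih =>
    rcases List.append_eq_cons_iff.1 hσ with ⟨rfl, _⟩ | ⟨σ', rfl, h⟩
    · exact .top
    · exact .refusal h1 h2 (ih h.symm)
  | timeoutRef h1 h2 h3 _ ih =>
    rcases List.append_eq_cons_iff.1 hσ with ⟨rfl, _⟩ | ⟨σ', rfl, h⟩
    · exact .top
    · exact .timeoutRef h1 h2 h3 (ih (by simp [h]))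
  | timeoutAct h1 h2 h3 _ h5 ih =>
    rcases List.append_eq_cons_iff.1 hσ with ⟨rfl, _⟩ | ⟨σ', rfl, h⟩
    · exact .top
    · rcases List.append_eq_cons_iff.1 h.symm with ⟨rfl, _⟩ | ⟨σ'', rfl, h'⟩
      · exact .refusal h1 h2 .top
      · exact .timeoutAct h1 h2 h3 (ih (by simp [h'])) h5

theorem fft_empty_refusal {P : Expr} {X : Set ℕ} {σ : PFT} (h : fft P (Sum.inr X :: σ)) :
    fft P [Sum.inr ∅] :=
  fft_of_append (ρ := Sum.inr X :: σ) (fft_refusal_cons (Set.empty_subset X) h)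

theorem fft_refusal_dedup {P : Expr} {X : Set ℕ} {σ : PFT}
    (h : fft P (Sum.inr X :: Sum.inr X :: σ)) : fft P (Sum.inr X :: σ) := by
  generalize hσ : (Sum.inr X :: Sum.inr X :: σ : PFT) = ρ at h
  induction h with
  | top => simp at hσ
  | act => simp at hσ
  | tau hs _ ih => exact .tau hs (ih hσ)
  | refusal h1 h2 h3 _ =>
    obtain ⟨h, rfl⟩ := List.cons.inj hσ
    exact h3
  | timeoutRef h1 h2 h3 _ ih =>
    obtain ⟨h, rfl⟩ := List.cons.inj hσ
    cases h
    exact .timeoutRef h1 h2 h3 (ih rfl)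
  | timeoutAct => simp at hσ

/-- Partial failure traces are preserved by strong bisimulations. -/
theorem fft_of_bisim {B : Expr → Expr → Prop} (hB : ∀ P Q, B P Q → B Q P)
    (hs : ∀ P Q α P', B P Q → Step P α P' → ∃ Q', Step Q α Q' ∧ B P' Q')
    {P Q : Expr} {σ : PFT} (h : fft P σ) (hPQ : B P Q) : fft Q σ := by
  have hst : ∀ {P Q}, B P Q → stable P → stable Q := fun {P Q} hb h ⟨Q', hq⟩ =>
    let ⟨P', hp, _⟩ := hs _ _ _ _ (hB _ _ hb) hq
    h ⟨P', hp⟩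
  have hin : ∀ {P Q}, B P Q → ∀ {X : Set ℕ}, (∀ a ∈ X, a ∉ initials P) →
      ∀ a ∈ X, a ∉ initials Q := fun {P Q} hb {X} h a ha ⟨Q', hq⟩ =>
    let ⟨P', hp, _⟩ := hs _ _ _ _ (hB _ _ hb) hq
    h a ha ⟨P', hp⟩
  induction h generalizing Q with
  | top => exact .top
  | act h1 _ ih =>
    obtain ⟨Q', hq, hb⟩ := hs _ _ _ _ hPQ h1
    exact .act hq (ih hb)
  | tau h1 _ ih =>
    obtain ⟨Q', hq, hb⟩ := hs _ _ _ _ hPQ h1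
    exact .tau hq (ih hb)
  | refusal h1 h2 _ ih => exact .refusal (hin hPQ h1) (hst hPQ h2) (ih hPQ)
  | timeoutRef h1 h2 h3 _ ih =>
    obtain ⟨Q', hq, hb⟩ := hs _ _ _ _ hPQ h3
    exact .timeoutRef (hin hPQ h1) (hst hPQ h2) hq (ih hb)
  | timeoutAct h1 h2 h3 _ h5 ih =>
    obtain ⟨Q', hq, hb⟩ := hs _ _ _ _ hPQ h3
    exact .timeoutAct (hin hPQ h1) (hst hPQ h2) hq (ih hb) h5

/-! ### Lifting traces through an operator -/

/-- The operator `f` propagates `τ` and time-out transitions of its argument, and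
`f P` refuses `X` as soon as `P` refuses `Y`. -/
structure Lifts (f : Expr → Expr) (X Y : Set ℕ) : Prop where
  tau : ∀ {P P'}, Step P .tau P' → Step (f P) .tau (f P')
  timeout : ∀ {P P'}, Step P .timeout P' → Step (f P) .timeout (f P')
  refuses : ∀ {P}, Refuses P Y → Refuses (f P) X

theorem Lifts.fft_refusal {f : Expr → Expr} {X Y : Set ℕ} (hf : Lifts f X Y) {σ ρ : PFT}
    (h₁ : ∀ P, Refuses P Y → fft P σ → fft (f P) (Sum.inr X :: ρ))
    (h₂ : ∀ P P' a σ', Refuses P Y → Step P .timeout P' → σ = Sum.inl a :: σ' → a ∈ Y →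
      fft P' σ → fft (f P) (Sum.inr X :: ρ))
    {P : Expr} (h : fft P (Sum.inr Y :: σ)) : fft (f P) (Sum.inr X :: ρ) := by
  generalize hσ : (Sum.inr Y :: σ : PFT) = π at h
  induction h with
  | top => simp at hσ
  | act => simp at hσ
  | tau hs _ ih => exact .tau (hf.tau hs) (ih hσ)
  | refusal h1 h2 h3 _ =>
    obtain ⟨h, rfl⟩ := List.cons.inj hσ
    cases h
    exact h₁ _ ⟨h2, h1⟩ h3
  | timeoutRef h1 h2 h3 _ ih =>
    obtain ⟨h, rfl⟩ := List.cons.inj hσ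
    cases h
    have hr := hf.refuses ⟨h2, h1⟩
    exact .timeoutRef hr.2 hr.1 (hf.timeout h3) (ih rfl)
  | timeoutAct h1 h2 h3 h4 h5 _ =>
    obtain ⟨h, rfl⟩ := List.cons.inj hσ
    cases h
    exact h₂ _ _ _ _ ⟨h2, h1⟩ h3 rfl h5 h4

theorem Lifts.refusal {f : Expr → Expr} {X Y : Set ℕ} (hf : Lifts f X Y) {σ ρ : PFT} {Q : Expr}
    (hQ : Refuses Q Y) (hσ : fft Q σ)
    (h : ∀ P, Refuses P Y → fft P σ → fft (f P) (Sum.inr X :: ρ)) :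
    fft Q (Sum.inr Y :: σ) ∧ ∀ P, fft P (Sum.inr Y :: σ) → fft (f P) (Sum.inr X :: ρ) := by
  refine ⟨.refusal hQ.2 hQ.1 hσ, fun P => hf.fft_refusal h ?_⟩
  rintro P P' a σ' - - rfl ha -
  exact (hQ.not_fft_act ha hσ).elim

theorem Lifts.timeoutAct {f : Expr → Expr} {X Y : Set ℕ} (hf : Lifts f X Y) {σ ρ : PFT} {a : ℕ}
    {Q Q' : Expr} (hQ : Refuses Q Y) (hQ' : Step Q .timeout Q') (hσ : fft Q' (Sum.inl a :: σ))
    (ha : a ∈ Y)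
    (h : ∀ P P', Refuses P Y → Step P .timeout P' → fft P' (Sum.inl a :: σ) →
      fft (f P) (Sum.inr X :: ρ)) :
    fft Q (Sum.inr Y :: Sum.inl a :: σ) ∧
      ∀ P, fft P (Sum.inr Y :: Sum.inl a :: σ) → fft (f P) (Sum.inr X :: ρ) :=
  ⟨.timeoutAct hQ.2 hQ.1 hQ' hσ ha, fun _ => hf.fft_refusal
    (fun _ hP h' => (hP.not_fft_act ha h').elim)
    (fun _ _ _ _ hP hs _ _ h' => h _ _ hP hs h')⟩

theorem fft_act_lift {f : Expr → Expr} {σ ρ : PFT} {a : ℕ}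
    (hτ : ∀ {P P'}, Step P .tau P' → Step (f P) .tau (f P'))
    (h : ∀ P P', Step P (.act a) P' → fft P' σ → fft (f P) ρ)
    {P : Expr} (hP : fft P (Sum.inl a :: σ)) : fft (f P) ρ := by
  generalize hσ : (Sum.inl a :: σ : PFT) = π at hP
  induction hP with
  | act h1 h2 _ =>
    obtain ⟨h', rfl⟩ := List.cons.inj hσ
    cases h'
    exact h _ _ h1 h2
  | tau hs _ ih => exact .tau (hτ hs) (ih hσ)
  | top => simp at hσ
  | refusal => simp at hσ
  | timeoutRef => simp at hσ
  | timeoutAct => simp at hσ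

/-! ### The rooted preorder -/

/-- Componentwise description of the inclusion `rfft(Q) ⊆ rfft(P)`. -/
structure RootedLE (Q P : Expr) : Prop where
  plain : ∀ {σ}, fft Q σ → fft P σ
  stable : stable Q → stable P
  rooted : ∀ {X σ Q'}, Refuses Q X → Step Q .timeout Q' → fft Q' (Sum.inr X :: σ) →
    ∃ P', Step P .timeout P' ∧ fft P' (Sum.inr X :: σ)
  unstable : fft Q [Sum.inr ∅] → _root_.stable P → _root_.stable Q

theorem RootedLE.refuses {Q P : Expr} (h : RootedLE Q P) {X : Set ℕ} (hQ : Refuses Q X) :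
    Refuses P X :=
  refuses_of_stable (h.stable hQ.1) (h.plain (.refusal hQ.2 hQ.1 .top))

theorem rfftSet_subset_iff {P Q : Expr} : rfftSet Q ⊆ rfftSet P ↔ RootedLE Q P := by
  constructor
  · intro h
    refine ⟨fun {σ} hσ => ?_, fun hs => ?_, fun {X σ Q'} hX hs hf => ?_, fun h0 hs => ?_⟩
    · have := h (a := .plain σ) (Or.inl ⟨σ, rfl, hσ⟩)
      simpa [rfftSet] using this
    · have := h (a := .st) (Or.inr (Or.inl ⟨rfl, hs⟩))
      simpa [rfftSet] using this
    · have := h (a := .rooted X σ) (Or.inr (Or.inr (Or.inl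
        ⟨X, σ, rfl, hX.1, hX.2, Q', hs, hf⟩)))
      simp only [rfftSet, Set.mem_ofPred_eq, reduceCtorEq, false_and, exists_false,
        RPFT.rooted.injEq, false_or, or_false] at this
      obtain ⟨X', σ', ⟨rfl, rfl⟩, -, -, h⟩ := this
      exact h
    · by_contra hq
      have := h (a := .postst) (Or.inr (Or.inr (Or.inr ⟨rfl, not_not.1 hq, h0⟩)))
      simp only [rfftSet, Set.mem_ofPred_eq, reduceCtorEq, false_and, exists_false,
        true_and, false_or] at this
      exact hs this.1
  · rintro h r (⟨σ, rfl, hσ⟩ | ⟨rfl, hs⟩ | ⟨X, σ, rfl, hs, hX, Q', ht, hf⟩ | ⟨rfl, hτ, h0⟩)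
    · exact Or.inl ⟨σ, rfl, h.plain hσ⟩
    · exact Or.inr (Or.inl ⟨rfl, h.stable hs⟩)
    · have hr := h.refuses ⟨hs, hX⟩
      exact Or.inr (Or.inr (Or.inl ⟨X, σ, rfl, hr.1, hr.2, h.rooted ⟨hs, hX⟩ ht hf⟩))
    · refine Or.inr (Or.inr (Or.inr ⟨rfl, ?_, h.plain h0⟩))
      by_contra hP
      exact h.unstable h0 hP hτ

theorem RootedLE.trans {P Q R : Expr} (h : RootedLE P Q) (h' : RootedLE Q R) : RootedLE P R where
  plain hσ := h'.plain (h.plain hσ)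
  stable hs := h'.stable (h.stable hs)
  rooted hX hs hf := by
    obtain ⟨Q', hq, hf⟩ := h.rooted hX hs hf
    exact h'.rooted (h.refuses hX) hq hf
  unstable h0 hs := h.unstable h0 (h'.unstable (h.plain h0) hs)

theorem RootedLE.timeoutAct {Q P : Expr} (h : RootedLE Q P) {Y : Set ℕ} {a : ℕ} {σ : PFT}
    {Q' : Expr} (hQ : Refuses Q Y) (hs : Step Q .timeout Q') (hf : fft Q' (Sum.inl a :: σ))
    (ha : a ∈ Y) : ∃ P', Step P .timeout P' ∧
      (fft P' (Sum.inl a :: σ) ∨ fft P' (Sum.inr Y :: Sum.inl a :: σ)) := by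
  have hP := h.refuses hQ
  cases h.plain (.timeoutAct hQ.2 hQ.1 hs hf ha) with
  | tau hs _ => exact (hP.1 ⟨_, hs⟩).elim
  | refusal _ _ h3 => exact (hP.not_fft_act ha h3).elim
  | timeoutRef _ _ h3 h4 => exact ⟨_, h3, Or.inr h4⟩
  | timeoutAct _ _ h3 h4 _ => exact ⟨_, h3, Or.inl h4⟩

theorem rootedLE_of_bisim {B : Expr → Expr → Prop} (hB : ∀ P Q, B P Q → B Q P)
    (hs : ∀ P Q α P', B P Q → Step P α P' → ∃ Q', Step Q α Q' ∧ B P' Q')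
    {P Q : Expr} (hPQ : B P Q) : RootedLE P Q where
  plain hσ := fft_of_bisim hB hs hσ hPQ
  stable := fun hP ⟨Q', hq⟩ =>
    let ⟨P', hp, _⟩ := hs _ _ _ _ (hB _ _ hPQ) hq
    hP ⟨P', hp⟩
  rooted _ ht hf := by
    obtain ⟨Q', hq, hb⟩ := hs _ _ _ _ hPQ ht
    exact ⟨Q', hq, fft_of_bisim hB hs hf hb⟩
  unstable := fun _ hQ ⟨P', hp⟩ =>
    let ⟨Q', hq, _⟩ := hs _ _ _ _ hPQ hp
    hQ ⟨Q', hq⟩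

/-! ### Prefixing -/

theorem fft_pre_mono {P Q : Expr} {α : Act} (h : ∀ {σ}, fft Q σ → fft P σ) {σ : PFT}
    (hσ : fft (.pre α Q) σ) : fft (.pre α P) σ := by
  have hst : stable (.pre α Q) → stable (.pre α P) := by
    rintro hs ⟨_, ⟨⟩⟩
    exact hs ⟨_, .pre⟩
  have hin : initials (.pre α P) ⊆ initials (.pre α Q) := by
    rintro a ⟨_, ⟨⟩⟩
    exact ⟨_, .pre⟩
  generalize hT : Expr.pre α Q = T at hσ
  induction hσ with
  | top => exact .top
  | act hs hf =>
    subst hT; cases hs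
    exact .act .pre (h hf)
  | tau hs hf =>
    subst hT; cases hs
    exact .tau .pre (h hf)
  | refusal h1 h2 _ ih =>
    subst hT
    exact .refusal (fun a ha hi => h1 a ha (hin hi)) (hst h2) (ih rfl)
  | timeoutRef h1 h2 h3 h4 =>
    subst hT; cases h3
    exact .timeoutRef (fun a ha hi => h1 a ha (hin hi)) (hst h2) .pre (h h4)
  | timeoutAct h1 h2 h3 h4 h5 =>
    subst hT; cases h3
    exact .timeoutAct (fun a ha hi => h1 a ha (hin hi)) (hst h2) .pre (h h4) h5

theorem RootedLE.pre {P Q : Expr} (h : RootedLE Q P) (α : Act) :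
    RootedLE (.pre α Q) (.pre α P) where
  plain := fft_pre_mono h.plain
  stable := by
    rintro hs ⟨_, ⟨⟩⟩
    exact hs ⟨_, .pre⟩
  rooted := by
    rintro X σ _ - ⟨⟩ hf
    exact ⟨_, .pre, h.plain hf⟩
  unstable := by
    rintro - hs ⟨_, ⟨⟩⟩
    exact hs ⟨_, .pre⟩

/-! ### Choice -/

theorem stable_choice {P R : Expr} : stable (.choice P R) ↔ stable P ∧ stable R := by
  constructor
  · exact fun h => ⟨fun ⟨_, hs⟩ => h ⟨_, .choiceL hs⟩, fun ⟨_, hs⟩ => h ⟨_, .choiceR hs⟩⟩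
  · rintro ⟨h1, h2⟩ ⟨_, hs⟩
    cases hs with
    | choiceL hs => exact h1 ⟨_, hs⟩
    | choiceR hs => exact h2 ⟨_, hs⟩

theorem refuses_choice {P R : Expr} {X : Set ℕ} :
    Refuses (.choice P R) X ↔ Refuses P X ∧ Refuses R X := by
  constructor
  · intro h
    have hs := stable_choice.1 h.1
    exact ⟨⟨hs.1, fun a ha ⟨_, hi⟩ => h.2 a ha ⟨_, .choiceL hi⟩⟩,
      ⟨hs.2, fun a ha ⟨_, hi⟩ => h.2 a ha ⟨_, .choiceR hi⟩⟩⟩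
  · rintro ⟨h1, h2⟩
    refine ⟨stable_choice.2 ⟨h1.1, h2.1⟩, ?_⟩
    rintro a ha ⟨_, hs⟩
    cases hs with
    | choiceL hs => exact h1.2 a ha ⟨_, hs⟩
    | choiceR hs => exact h2.2 a ha ⟨_, hs⟩

theorem fft_choice_of_act {P R : Expr} {a : ℕ} {σ : PFT} (h : fft P (Sum.inl a :: σ)) :
    fft (.choice P R) (Sum.inl a :: σ) := by
  cases h with
  | act hs hf => exact .act (.choiceL hs) hf
  | tau hs hf => exact .tau (.choiceL hs) hf

theorem fft_choice_of_unstable {P R : Expr} {σ : PFT} (hP : ¬ stable P) (h : fft P σ) :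
    fft (.choice P R) σ := by
  rcases σ with _ | ⟨a | X, σ⟩
  · exact .top
  · exact fft_choice_of_act h
  · obtain ⟨P', hs, hf⟩ := fft_refusal_tau hP h
    exact .tau (.choiceL hs) hf

theorem fft_choice_mono {P Q R : Expr} (h : RootedLE Q P) {σ : PFT}
    (hσ : fft (.choice Q R) σ) : fft (.choice P R) σ := by
  have hre : ∀ {X}, Refuses (.choice Q R) X → Refuses (.choice P R) X := fun hX =>
    refuses_choice.2 ⟨h.refuses (refuses_choice.1 hX).1, (refuses_choice.1 hX).2⟩
  generalize hT : Expr.choice Q R = T at hσ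
  induction hσ with
  | top => exact .top
  | act hs hf =>
    subst hT
    cases hs with
    | choiceL hs => exact fft_choice_of_act (h.plain (.act hs hf))
    | choiceR hs => exact .act (.choiceR hs) hf
  | @tau _ _ ρ hs hf =>
    subst hT
    cases hs with
    | choiceL hs =>
      have hQ : fft Q ρ := .tau hs hf
      by_cases hP : stable P
      · rcases ρ with _ | ⟨a | X, σ⟩
        · exact .top
        · exact fft_choice_of_act (h.plain hQ)
        · exact (h.unstable (fft_empty_refusal hQ) hP ⟨_, hs⟩).elim
      · exact fft_choice_of_unstable hP (h.plain hQ)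
    | choiceR hs => exact .tau (.choiceR hs) hf
  | refusal h1 h2 _ ih =>
    subst hT
    have hr := hre ⟨h2, h1⟩
    exact .refusal hr.2 hr.1 (ih rfl)
  | timeoutRef h1 h2 h3 h4 =>
    subst hT
    have hr := hre ⟨h2, h1⟩
    cases h3 with
    | choiceL hs =>
      obtain ⟨P', hs, hf⟩ := h.rooted (refuses_choice.1 ⟨h2, h1⟩).1 hs h4
      exact .timeoutRef hr.2 hr.1 (.choiceL hs) hf
    | choiceR hs => exact .timeoutRef hr.2 hr.1 (.choiceR hs) h4
  | timeoutAct h1 h2 h3 h4 h5 =>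
    subst hT
    have hr := hre ⟨h2, h1⟩
    cases h3 with
    | choiceL hs =>
      obtain ⟨P', hs, hf | hf⟩ := h.timeoutAct (refuses_choice.1 ⟨h2, h1⟩).1 hs h4 h5
      · exact .timeoutAct hr.2 hr.1 (.choiceL hs) hf h5
      · exact .timeoutRef hr.2 hr.1 (.choiceL hs) hf
    | choiceR hs => exact .timeoutAct hr.2 hr.1 (.choiceR hs) h4 h5

theorem RootedLE.choice {P Q : Expr} (h : RootedLE Q P) (R : Expr) :
    RootedLE (.choice Q R) (.choice P R) where
  plain := fft_choice_mono h
  stable hs := stable_choice.2 ⟨h.stable (stable_choice.1 hs).1, (stable_choice.1 hs).2⟩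
  rooted := by
    rintro X σ _ hX hs hf
    cases hs with
    | choiceL hs =>
      obtain ⟨P', hs, hf⟩ := h.rooted (refuses_choice.1 hX).1 hs hf
      exact ⟨P', .choiceL hs, hf⟩
    | choiceR hs => exact ⟨_, .choiceR hs, hf⟩
  unstable := by
    intro h0 hs
    obtain ⟨hP, hR⟩ := stable_choice.1 hs
    by_contra hu
    obtain ⟨T, hT, hf⟩ := fft_refusal_tau hu h0
    cases hT with
    | choiceL hq => exact h.unstable (.tau hq hf) hP ⟨_, hq⟩
    | choiceR hq => exact hR ⟨_, hq⟩

theorem choice_comm_rootedLE (P R : Expr) : RootedLE (.choice P R) (.choice R P) := by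
  refine rootedLE_of_bisim
    (B := fun E F => E = F ∨ ∃ P R, E = .choice P R ∧ F = .choice R P) ?_ ?_
    (Or.inr ⟨P, R, rfl, rfl⟩)
  · rintro E F (rfl | ⟨P, R, rfl, rfl⟩)
    · exact Or.inl rfl
    · exact Or.inr ⟨R, P, rfl, rfl⟩
  · rintro E F α E' (rfl | ⟨P, R, rfl, rfl⟩) hs
    · exact ⟨E', hs, Or.inl rfl⟩
    · cases hs with
      | choiceL hs => exact ⟨E', .choiceR hs, Or.inl rfl⟩
      | choiceR hs => exact ⟨E', .choiceL hs, Or.inl rfl⟩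

/-! ### Parallel composition -/

theorem tau_notIn (S : Set ℕ) : Act.tau.notIn S := by simp [Act.notIn]

theorem timeout_notIn (S : Set ℕ) : Act.timeout.notIn S := by simp [Act.notIn]

theorem act_notIn {a : ℕ} {S : Set ℕ} : (Act.act a).notIn S ↔ a ∉ S := by simp [Act.notIn]

theorem stable_par {S : Set ℕ} {P R : Expr} : stable (.par S P R) ↔ stable P ∧ stable R := by
  constructor
  · exact fun h => ⟨fun ⟨_, hs⟩ => h ⟨_, .parL hs (tau_notIn S)⟩,
      fun ⟨_, hs⟩ => h ⟨_, .parR hs (tau_notIn S)⟩⟩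
  · rintro ⟨h1, h2⟩ ⟨_, hs⟩
    cases hs with
    | parL hs => exact h1 ⟨_, hs⟩
    | parR hs => exact h2 ⟨_, hs⟩

/-- The part of `X` that `P` must refuse in order for `P ∥_S R` to refuse `X`. -/
def parRefusal (S : Set ℕ) (R : Expr) (X : Set ℕ) : Set ℕ := {a ∈ X | a ∈ S → a ∈ initials R}

theorem refuses_par {S : Set ℕ} {P R : Expr} {X : Set ℕ} :
    Refuses (.par S P R) X ↔ Refuses P (parRefusal S R X) ∧ Refuses R (X \ S) := by
  constructor
  · intro h
    have hs := stable_par.1 h.1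
    refine ⟨⟨hs.1, ?_⟩, ⟨hs.2, ?_⟩⟩
    · rintro a ⟨ha, haS⟩ ⟨_, hi⟩
      by_cases hS : a ∈ S
      · obtain ⟨_, hr⟩ := haS hS
        exact h.2 a ha ⟨_, .parSync hi hr hS⟩
      · exact h.2 a ha ⟨_, .parL hi (act_notIn.2 hS)⟩
    · rintro a ⟨ha, hS⟩ ⟨_, hi⟩
      exact h.2 a ha ⟨_, .parR hi (act_notIn.2 hS)⟩
  · rintro ⟨h1, h2⟩
    refine ⟨stable_par.2 ⟨h1.1, h2.1⟩, ?_⟩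
    rintro a ha ⟨_, hs⟩
    cases hs with
    | parL hs hn => exact h1.2 a ⟨ha, fun hS => (act_notIn.1 hn hS).elim⟩ ⟨_, hs⟩
    | parR hs hn => exact h2.2 a ⟨ha, act_notIn.1 hn⟩ ⟨_, hs⟩
    | parSync hs hr hS => exact h1.2 a ⟨ha, fun _ => ⟨_, hr⟩⟩ ⟨_, hs⟩

theorem lifts_par {S : Set ℕ} {R : Expr} {X : Set ℕ} (hR : Refuses R (X \ S)) :
    Lifts (fun P => .par S P R) X (parRefusal S R X) where
  tau hs := .parL hs (tau_notIn S)
  timeout hs := .parL hs (timeout_notIn S)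
  refuses hP := refuses_par.2 ⟨hP, hR⟩

/-- Each partial failure trace of `Q ∥_S R` stems from one of `Q`, in such a way that
every process with the latter trace yields the former one in parallel with `R`. -/
theorem fft_par_decomp {S : Set ℕ} {Q R : Expr} {σ : PFT} (h : fft (.par S Q R) σ) :
    ∃ σ₁, fft Q σ₁ ∧ (∀ P, fft P σ₁ → fft (.par S P R) σ) ∧
      (stable R → ∀ X ρ, σ = Sum.inr X :: ρ → ∃ σ', σ₁ = Sum.inr (parRefusal S R X) :: σ') ∧
      (stable R → ∀ a ρ, σ = Sum.inl a :: ρ → (a ∉ S → a ∉ initials R) →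
        (∃ σ', σ₁ = Sum.inl a :: σ') ∧ (a ∈ S → a ∈ initials R)) := by
  generalize hT : Expr.par S Q R = T at h
  induction h generalizing Q R with
  | top => exact ⟨[], .top, fun _ _ => .top, by simp, by simp⟩
  | @act _ _ a ρ hs hf ih =>
    subst hT
    cases hs with
    | parL hs hn =>
      obtain ⟨σ₁, h1, h2, -, -⟩ := ih rfl
      refine ⟨Sum.inl a :: σ₁, .act hs h1, fun P hP => ?_, by simp, ?_⟩
      · exact fft_act_lift (f := fun P => .par S P R) (fun hs => .parL hs (tau_notIn S))
          (fun P P' hs hf => .act (.parL hs hn) (h2 _ hf)) hP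
      · rintro - b _ hb -
        cases hb
        exact ⟨⟨_, rfl⟩, fun hS => (act_notIn.1 hn hS).elim⟩
    | parR hs hn =>
      obtain ⟨σ₁, h1, h2, -, -⟩ := ih rfl
      refine ⟨σ₁, h1, fun P hP => .act (.parR hs hn) (h2 _ hP), by simp, ?_⟩
      rintro - b _ hb hi
      cases hb
      exact (hi (act_notIn.1 hn) ⟨_, hs⟩).elim
    | parSync hs hr hS =>
      obtain ⟨σ₁, h1, h2, -, -⟩ := ih rfl
      refine ⟨Sum.inl a :: σ₁, .act hs h1, fun P hP => ?_, by simp, ?_⟩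
      · exact fft_act_lift (f := fun P => .par S P R) (fun hs => .parL hs (tau_notIn S))
          (fun P P' hs hf => .act (.parSync hs hr hS) (h2 _ hf)) hP
      · rintro - b _ hb -
        cases hb
        exact ⟨⟨_, rfl⟩, fun _ => ⟨_, hr⟩⟩
  | tau hs hf ih =>
    subst hT
    cases hs with
    | parL hs hn =>
      obtain ⟨σ₁, h1, h2, h3, h4⟩ := ih rfl
      exact ⟨σ₁, .tau hs h1, h2, h3, h4⟩
    | parR hs hn =>
      obtain ⟨σ₁, h1, h2, -, -⟩ := ih rfl
      exact ⟨σ₁, h1, fun P hP => .tau (.parR hs hn) (h2 _ hP),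
        fun hR => (hR ⟨_, hs⟩).elim, fun hR => (hR ⟨_, hs⟩).elim⟩
  | @refusal _ X ρ h1 h2 hf ih =>
    subst hT
    obtain ⟨hQ, hR⟩ := refuses_par.1 ⟨h2, h1⟩
    obtain ⟨σ₁, g1, g2, -, -⟩ := ih rfl
    obtain ⟨k1, k2⟩ := (lifts_par hR).refusal (ρ := ρ) hQ g1 fun P hP hf =>
      have hr := refuses_par.2 ⟨hP, hR⟩
      .refusal hr.2 hr.1 (g2 _ hf)
    refine ⟨_, k1, k2, ?_, by simp⟩
    rintro - _ _ he
    cases he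
    exact ⟨_, rfl⟩
  | @timeoutRef _ _ X ρ h1 h2 hs hf ih =>
    subst hT
    obtain ⟨hQ, hR⟩ := refuses_par.1 ⟨h2, h1⟩
    cases hs with
    | parL hs hn =>
      obtain ⟨σ₁, g1, g2, g3, -⟩ := ih rfl
      obtain ⟨σ', rfl⟩ := g3 hR.1 X ρ rfl
      refine ⟨_, .timeoutRef hQ.2 hQ.1 hs g1, g2, g3, by simp⟩
    | parR hs hn =>
      obtain ⟨σ₁, g1, g2, -, -⟩ := ih rfl
      obtain ⟨k1, k2⟩ := (lifts_par hR).refusal (ρ := ρ) hQ g1 fun P hP hf =>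
        have hr := refuses_par.2 ⟨hP, hR⟩
        .timeoutRef hr.2 hr.1 (.parR hs hn) (g2 _ hf)
      refine ⟨_, k1, k2, ?_, by simp⟩
      rintro - _ _ he
      cases he
      exact ⟨_, rfl⟩
  | @timeoutAct _ _ X a ρ h1 h2 hs hf ha ih =>
    subst hT
    obtain ⟨hQ, hR⟩ := refuses_par.1 ⟨h2, h1⟩
    cases hs with
    | parL hs hn =>
      obtain ⟨σ₁, g1, g2, -, g4⟩ := ih rfl
      obtain ⟨⟨σ', rfl⟩, haR⟩ := g4 hR.1 a ρ rfl fun hS => hR.2 a ⟨ha, hS⟩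
      obtain ⟨k1, k2⟩ := (lifts_par hR).timeoutAct (ρ := Sum.inl a :: ρ) hQ hs g1 ⟨ha, haR⟩
        fun P P' hP hs hf =>
          have hr := refuses_par.2 ⟨hP, hR⟩
          .timeoutAct hr.2 hr.1 (.parL hs hn) (g2 _ hf) ha
      refine ⟨_, k1, k2, ?_, by simp⟩
      rintro - _ _ he
      cases he
      exact ⟨_, rfl⟩
    | parR hs hn =>
      obtain ⟨σ₁, g1, g2, -, -⟩ := ih rfl
      obtain ⟨k1, k2⟩ := (lifts_par hR).refusal (ρ := Sum.inl a :: ρ) hQ g1 fun P hP hf =>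
        have hr := refuses_par.2 ⟨hP, hR⟩
        .timeoutAct hr.2 hr.1 (.parR hs hn) (g2 _ hf) ha
      refine ⟨_, k1, k2, ?_, by simp⟩
      rintro - _ _ he
      cases he
      exact ⟨_, rfl⟩

theorem fft_par_mono {S : Set ℕ} {P Q R : Expr} (h : ∀ {σ}, fft Q σ → fft P σ) {σ : PFT}
    (hσ : fft (.par S Q R) σ) : fft (.par S P R) σ := by
  obtain ⟨σ₁, h1, h2, -, -⟩ := fft_par_decomp hσ
  exact h2 _ (h h1)

theorem RootedLE.par {P Q : Expr} (h : RootedLE Q P) (S : Set ℕ) (R : Expr) :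
    RootedLE (.par S Q R) (.par S P R) where
  plain := fft_par_mono h.plain
  stable hs := stable_par.2 ⟨h.stable (stable_par.1 hs).1, (stable_par.1 hs).2⟩
  rooted := by
    rintro X σ _ hX hs hf
    obtain ⟨hQ, hR⟩ := refuses_par.1 hX
    cases hs with
    | parL hs hn =>
      obtain ⟨σ₁, g1, g2, g3, -⟩ := fft_par_decomp hf
      obtain ⟨σ', rfl⟩ := g3 hR.1 X σ rfl
      obtain ⟨P', hs, hf⟩ := h.rooted hQ hs g1
      exact ⟨_, .parL hs hn, g2 _ hf⟩
    | parR hs hn => exact ⟨_, .parR hs hn, fft_par_mono h.plain hf⟩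
  unstable := by
    intro h0 hs
    obtain ⟨hP, hR⟩ := stable_par.1 hs
    obtain ⟨σ₁, g1, -, g3, -⟩ := fft_par_decomp h0
    obtain ⟨σ', rfl⟩ := g3 hR _ _ rfl
    exact stable_par.2 ⟨h.unstable (fft_empty_refusal g1) hP, hR⟩

theorem par_comm_rootedLE (S : Set ℕ) (P R : Expr) :
    RootedLE (.par S P R) (.par S R P) := by
  refine rootedLE_of_bisim
    (B := fun E F => ∃ P R, E = .par S P R ∧ F = .par S R P) ?_ ?_ ⟨P, R, rfl, rfl⟩
  · rintro E F ⟨P, R, rfl, rfl⟩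
    exact ⟨R, P, rfl, rfl⟩
  · rintro E F α E' ⟨P, R, rfl, rfl⟩ hs
    cases hs with
    | parL hs hn => exact ⟨_, .parR hs hn, _, _, rfl, rfl⟩
    | parR hs hn => exact ⟨_, .parL hs hn, _, _, rfl, rfl⟩
    | parSync hs hr hS => exact ⟨_, .parSync hr hs hS, _, _, rfl, rfl⟩

/-! ### Abstraction -/

theorem stable_abs {I : Set ℕ} {P : Expr} : stable (.abs I P) ↔ Refuses P I := by
  constructor
  · exact fun h => ⟨fun ⟨_, hs⟩ => h ⟨_, .absFree hs (tau_notIn I)⟩,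
      fun a ha ⟨_, hs⟩ => h ⟨_, .absHide hs ha⟩⟩
  · rintro h ⟨_, hs⟩
    cases hs with
    | absFree hs _ => exact h.1 ⟨_, hs⟩
    | absHide hs ha => exact h.2 _ ha ⟨_, hs⟩

theorem refuses_abs {I X : Set ℕ} {P : Expr} : Refuses (.abs I P) X ↔ Refuses P (X ∪ I) := by
  constructor
  · intro h
    have hI := stable_abs.1 h.1
    refine ⟨hI.1, ?_⟩
    rintro a ha ⟨_, hs⟩
    by_cases haI : a ∈ I
    · exact hI.2 a haI ⟨_, hs⟩
    · exact h.2 a (ha.resolve_right haI) ⟨_, .absFree hs (act_notIn.2 haI)⟩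
  · intro h
    refine ⟨stable_abs.2 (h.mono Set.subset_union_right), ?_⟩
    rintro a ha ⟨_, hs⟩
    cases hs with
    | absFree hs _ => exact h.2 a (Or.inl ha) ⟨_, hs⟩

theorem lifts_abs (I X : Set ℕ) : Lifts (.abs I) X (X ∪ I) where
  tau hs := .absFree hs (tau_notIn I)
  timeout hs := .absFree hs (timeout_notIn I)
  refuses hP := refuses_abs.2 hP

/-- Each partial failure trace of `τ_I(Q)` stems from one of `Q`, in such a way that
every process with the latter trace yields the former one after abstraction from `I`. -/
theorem fft_abs_decomp {I : Set ℕ} {Q : Expr} {σ : PFT} (h : fft (.abs I Q) σ) :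
    ∃ σ₁, fft Q σ₁ ∧ (∀ P, fft P σ₁ → fft (.abs I P) σ) ∧
      (∀ X ρ, σ = Sum.inr X :: ρ →
        ∃ σ', σ₁ = Sum.inr (X ∪ I) :: σ' ∨ ∃ i ∈ I, σ₁ = Sum.inl i :: σ') ∧
      (∀ a ρ, σ = Sum.inl a :: ρ → ∃ i σ', (i = a ∨ i ∈ I) ∧ σ₁ = Sum.inl i :: σ') := by
  generalize hT : Expr.abs I Q = T at h
  induction h generalizing Q with
  | top => exact ⟨[], .top, fun _ _ => .top, by simp, by simp⟩
  | @act _ _ a ρ hs hf ih =>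
    subst hT
    cases hs with
    | absFree hs hn =>
      obtain ⟨σ₁, h1, h2, -, -⟩ := ih rfl
      refine ⟨Sum.inl a :: σ₁, .act hs h1, fun P hP => ?_, by simp, ?_⟩
      · exact fft_act_lift (f := .abs I) (fun hs => .absFree hs (tau_notIn I))
          (fun P P' hs hf => .act (.absFree hs hn) (h2 _ hf)) hP
      · rintro b _ hb
        cases hb
        exact ⟨_, _, Or.inl rfl, rfl⟩
  | @tau _ _ ρ hs hf ih =>
    subst hT
    cases hs with
    | absFree hs hn =>
      obtain ⟨σ₁, h1, h2, h3, h4⟩ := ih rfl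
      exact ⟨σ₁, .tau hs h1, h2, h3, h4⟩
    | @absHide _ _ i _ hs hi =>
      obtain ⟨σ₁, h1, h2, -, -⟩ := ih rfl
      refine ⟨Sum.inl i :: σ₁, .act hs h1, fun P hP => ?_,
        fun _ _ _ => ⟨σ₁, Or.inr ⟨i, hi, rfl⟩⟩, fun _ _ _ => ⟨i, σ₁, Or.inr hi, rfl⟩⟩
      exact fft_act_lift (f := .abs I) (fun hs => .absFree hs (tau_notIn I))
        (fun P P' hs hf => .tau (.absHide hs hi) (h2 _ hf)) hP
  | @refusal _ X ρ h1 h2 hf ih =>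
    subst hT
    have hQ := refuses_abs.1 ⟨h2, h1⟩
    obtain ⟨σ₁, g1, g2, -, -⟩ := ih rfl
    obtain ⟨k1, k2⟩ := (lifts_abs I X).refusal (ρ := ρ) hQ g1 fun P hP hf =>
      have hr := refuses_abs.2 hP
      .refusal hr.2 hr.1 (g2 _ hf)
    refine ⟨_, k1, k2, ?_, by simp⟩
    rintro _ _ he
    cases he
    exact ⟨_, Or.inl rfl⟩
  | @timeoutRef _ _ X ρ h1 h2 hs hf ih =>
    subst hT
    have hQ := refuses_abs.1 ⟨h2, h1⟩
    cases hs with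
    | absFree hs hn =>
      obtain ⟨σ₁, g1, g2, g3, -⟩ := ih rfl
      obtain ⟨σ', rfl | ⟨i, hi, rfl⟩⟩ := g3 X ρ rfl
      · exact ⟨_, .timeoutRef hQ.2 hQ.1 hs g1, g2, g3, by simp⟩
      · obtain ⟨k1, k2⟩ := (lifts_abs I X).timeoutAct (ρ := ρ) hQ hs g1 (Or.inr hi)
          fun P P' hP hs hf =>
            have hr := refuses_abs.2 hP
            .timeoutRef hr.2 hr.1 (.absFree hs hn) (g2 _ hf)
        refine ⟨_, k1, k2, ?_, by simp⟩
        rintro _ _ he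
        cases he
        exact ⟨_, Or.inl rfl⟩
  | @timeoutAct _ _ X a ρ h1 h2 hs hf ha ih =>
    subst hT
    have hQ := refuses_abs.1 ⟨h2, h1⟩
    cases hs with
    | absFree hs hn =>
      obtain ⟨σ₁, g1, g2, -, g4⟩ := ih rfl
      obtain ⟨i, σ', hi, rfl⟩ := g4 a ρ rfl
      have hiY : i ∈ X ∪ I := hi.imp (fun h => by rwa [h]) id
      obtain ⟨k1, k2⟩ := (lifts_abs I X).timeoutAct (ρ := Sum.inl a :: ρ) hQ hs g1 hiY
        fun P P' hP hs hf =>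
          have hr := refuses_abs.2 hP
          .timeoutAct hr.2 hr.1 (.absFree hs hn) (g2 _ hf) ha
      refine ⟨_, k1, k2, ?_, by simp⟩
      rintro _ _ he
      cases he
      exact ⟨_, Or.inl rfl⟩

theorem RootedLE.abs {P Q : Expr} (h : RootedLE Q P) (I : Set ℕ) :
    RootedLE (.abs I Q) (.abs I P) where
  plain hσ := by
    obtain ⟨σ₁, h1, h2, -, -⟩ := fft_abs_decomp hσ
    exact h2 _ (h.plain h1)
  stable hs := stable_abs.2 (h.refuses (stable_abs.1 hs))
  rooted := by
    rintro X σ _ hX hs hf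
    have hQ := refuses_abs.1 hX
    cases hs with
    | absFree hs hn =>
      obtain ⟨σ₁, g1, g2, g3, -⟩ := fft_abs_decomp hf
      obtain ⟨σ', rfl | ⟨i, hi, rfl⟩⟩ := g3 X σ rfl
      · obtain ⟨P', hs, hf⟩ := h.rooted hQ hs g1
        exact ⟨_, .absFree hs hn, g2 _ hf⟩
      · obtain ⟨k1, k2⟩ := (lifts_abs I X).timeoutAct (ρ := σ) hQ hs g1 (Or.inr hi)
          fun P P' hP hs hf =>
            have hr := refuses_abs.2 hP
            .timeoutRef hr.2 hr.1 (.absFree hs hn) (g2 _ hf)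
        obtain ⟨P', hs, hf | hf⟩ := h.timeoutAct hQ hs g1 (Or.inr hi)
        · exact ⟨_, .absFree hs hn, g2 _ hf⟩
        · exact ⟨_, .absFree hs hn, k2 _ hf⟩
  unstable := by
    intro h0 hs
    have hP := stable_abs.1 hs
    have hI : ∀ i ∈ I, ∀ σ, ¬ fft Q (Sum.inl i :: σ) := fun i hi σ hf =>
      hP.not_fft_act hi (h.plain hf)
    obtain ⟨σ₁, g1, -, g3, -⟩ := fft_abs_decomp h0
    obtain ⟨σ', rfl | ⟨i, hi, rfl⟩⟩ := g3 _ _ rfl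
    · exact stable_abs.2 ⟨h.unstable (fft_empty_refusal g1) hP.1,
        fun i hi ⟨_, hs⟩ => hI i hi [] (.act hs .top)⟩
    · exact (hI i hi _ g1).elim

/-! ### Renaming -/

theorem stable_ren {R : Set (ℕ × ℕ)} {P : Expr} : stable (.ren R P) ↔ stable P := by
  constructor
  · exact fun h ⟨_, hs⟩ => h ⟨_, .renTau hs⟩
  · rintro h ⟨_, hs⟩
    cases hs with
    | renTau hs => exact h ⟨_, hs⟩

/-- The actions that are renamed into an element of `X`. -/
def renPreimage (R : Set (ℕ × ℕ)) (X : Set ℕ) : Set ℕ := {a | ∃ b ∈ X, (a, b) ∈ R}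

theorem refuses_ren {R : Set (ℕ × ℕ)} {P : Expr} {X : Set ℕ} :
    Refuses (.ren R P) X ↔ Refuses P (renPreimage R X) := by
  constructor
  · refine fun h => ⟨stable_ren.1 h.1, ?_⟩
    rintro a ⟨b, hb, hR⟩ ⟨_, hs⟩
    exact h.2 b hb ⟨_, .renAct hs hR⟩
  · refine fun h => ⟨stable_ren.2 h.1, ?_⟩
    rintro b hb ⟨_, hs⟩
    cases hs with
    | renAct hs hR => exact h.2 _ ⟨b, hb, hR⟩ ⟨_, hs⟩

/-- The relation between the elements of partial failure traces of `P` and of `R(P)`. -/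
inductive RenElt (R : Set (ℕ × ℕ)) : Elt → Elt → Prop
  | act {a b} : (a, b) ∈ R → RenElt R (Sum.inl a) (Sum.inl b)
  | refusal {X} : RenElt R (Sum.inr (renPreimage R X)) (Sum.inr X)

theorem lifts_ren (R : Set (ℕ × ℕ)) (X : Set ℕ) : Lifts (.ren R) X (renPreimage R X) where
  tau hs := .renTau hs
  timeout hs := .renTimeout hs
  refuses hP := refuses_ren.2 hP

/-- Each partial failure trace of `R(Q)` stems from one of `Q`, in such a way that
every process with the latter trace yields the former one after renaming by `R`. -/
theorem fft_ren_decomp {R : Set (ℕ × ℕ)} {Q : Expr} {σ : PFT} (h : fft (.ren R Q) σ) :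
    ∃ σ₁, fft Q σ₁ ∧ (∀ P, fft P σ₁ → fft (.ren R P) σ) ∧ List.Forall₂ (RenElt R) σ₁ σ := by
  generalize hT : Expr.ren R Q = T at h
  induction h generalizing Q with
  | top => exact ⟨[], .top, fun _ _ => .top, .nil⟩
  | act hs hf ih =>
    subst hT
    cases hs with
    | @renAct _ _ _ a b hs hR =>
      obtain ⟨σ₁, h1, h2, h3⟩ := ih rfl
      refine ⟨Sum.inl a :: σ₁, .act hs h1, fun P hP => ?_, .cons (.act hR) h3⟩
      exact fft_act_lift (f := .ren R) (fun hs => .renTau hs)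
        (fun P P' hs hf => .act (.renAct hs hR) (h2 _ hf)) hP
  | tau hs hf ih =>
    subst hT
    cases hs with
    | renTau hs =>
      obtain ⟨σ₁, h1, h2⟩ := ih rfl
      exact ⟨σ₁, .tau hs h1, h2⟩
  | @refusal _ X ρ h1 h2 hf ih =>
    subst hT
    have hQ := refuses_ren.1 ⟨h2, h1⟩
    obtain ⟨σ₁, g1, g2, g3⟩ := ih rfl
    obtain ⟨k1, k2⟩ := (lifts_ren R X).refusal (ρ := ρ) hQ g1 fun P hP hf =>
      have hr := refuses_ren.2 hP
      .refusal hr.2 hr.1 (g2 _ hf)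
    exact ⟨_, k1, k2, .cons .refusal g3⟩
  | @timeoutRef _ _ X ρ h1 h2 hs hf ih =>
    subst hT
    have hQ := refuses_ren.1 ⟨h2, h1⟩
    cases hs with
    | renTimeout hs =>
      obtain ⟨σ₁, g1, g2, g3⟩ := ih rfl
      cases g3 with
      | cons he g3 =>
        cases he
        exact ⟨_, .timeoutRef hQ.2 hQ.1 hs g1, g2, .cons .refusal g3⟩
  | @timeoutAct _ _ X b ρ h1 h2 hs hf hb ih =>
    subst hT
    have hQ := refuses_ren.1 ⟨h2, h1⟩
    cases hs with
    | renTimeout hs =>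
      obtain ⟨σ₁, g1, g2, g3⟩ := ih rfl
      cases g3 with
      | cons he g3 =>
        cases he with
        | act hR =>
          obtain ⟨k1, k2⟩ := (lifts_ren R X).timeoutAct (ρ := Sum.inl b :: ρ) hQ hs g1
            ⟨b, hb, hR⟩ fun P P' hP hs hf =>
              have hr := refuses_ren.2 hP
              .timeoutAct hr.2 hr.1 (.renTimeout hs) (g2 _ hf) hb
          exact ⟨_, k1, k2, .cons .refusal (.cons (.act hR) g3)⟩

theorem RootedLE.ren {P Q : Expr} (h : RootedLE Q P) (R : Set (ℕ × ℕ)) :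
    RootedLE (.ren R Q) (.ren R P) where
  plain hσ := by
    obtain ⟨σ₁, h1, h2, -⟩ := fft_ren_decomp hσ
    exact h2 _ (h.plain h1)
  stable hs := stable_ren.2 (h.stable (stable_ren.1 hs))
  rooted := by
    rintro X σ _ hX hs hf
    cases hs with
    | renTimeout hs =>
      obtain ⟨σ₁, g1, g2, g3⟩ := fft_ren_decomp hf
      cases g3 with
      | cons he g3 =>
        cases he
        obtain ⟨P', hs, hf⟩ := h.rooted (refuses_ren.1 hX) hs g1
        exact ⟨_, .renTimeout hs, g2 _ hf⟩
  unstable := by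
    intro h0 hs
    obtain ⟨σ₁, g1, -, g3⟩ := fft_ren_decomp h0
    cases g3 with
    | cons he g3 =>
      cases he
      exact stable_ren.2 (h.unstable (fft_empty_refusal g1) (stable_ren.1 hs))

/-- The rooted partial failure trace preorder is a precongruence. -/
theorem RootedLE.fill {P Q : Expr} (h : RootedLE Q P) (C : Ctx) :
    RootedLE (C.fill Q) (C.fill P) := by
  induction C with
  | hole => exact h
  | pre α C ih => exact ih.pre α
  | choiceL C R ih => exact ih.choice R
  | choiceR R C ih =>
    exact (choice_comm_rootedLE _ _).trans ((ih.choice R).trans (choice_comm_rootedLE _ _))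
  | parL S C R ih => exact ih.par S R
  | parR S R C ih =>
    exact (par_comm_rootedLE _ _ _).trans ((ih.par S R).trans (par_comm_rootedLE _ _ _))
  | abs I C ih => exact ih.abs I
  | ren R C ih => exact ih.ren R

/-! ### Distinguishing contexts -/

/-- The renaming `n ↦ n + 1`, which makes the action `0` fresh. -/
def shift : Set (ℕ × ℕ) := {p | p.2 = p.1 + 1}

theorem shift_finite (a : ℕ) : {b | (a, b) ∈ shift}.Finite := by
  simp [shift]

theorem renPreimage_shift (X : Set ℕ) : renPreimage shift X = {a | a + 1 ∈ X} := by
  ext a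
  simp [renPreimage, shift]

theorem fft_shift {P : Expr} {σ σ' : PFT} (h : fft P σ)
    (hσ : List.Forall₂ (RenElt shift) σ σ') : fft (.ren shift P) σ' := by
  induction h generalizing σ' with
  | top => cases hσ; exact .top
  | act hs _ ih =>
    cases hσ with
    | cons he hσ =>
      cases he with
      | act hR => exact .act (.renAct hs hR) (ih hσ)
  | tau hs _ ih => exact .tau (.renTau hs) (ih hσ)
  | refusal h1 h2 _ ih =>
    cases hσ with
    | cons he hσ =>
      cases he
      have hr := refuses_ren.2 ⟨h2, h1⟩
      exact .refusal hr.2 hr.1 (ih hσ)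
  | timeoutRef h1 h2 hs _ ih =>
    cases hσ with
    | cons he hσ =>
      cases he
      have hr := refuses_ren.2 ⟨h2, h1⟩
      exact .timeoutRef hr.2 hr.1 (.renTimeout hs) (ih (.cons .refusal hσ))
  | timeoutAct h1 h2 hs _ ha ih =>
    cases hσ with
    | cons he hσ =>
      cases he
      have hr := refuses_ren.2 ⟨h2, h1⟩
      cases hσ with
      | cons he hσ =>
        cases he with
        | act hR =>
          obtain ⟨b, hb, hR'⟩ := ha
          obtain rfl := hR.trans hR'.symm
          exact .timeoutAct hr.2 hr.1 (.renTimeout hs) (ih (.cons (.act hR) hσ)) hb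

theorem renPreimage_shift_image (X : Set ℕ) : renPreimage shift (Nat.succ '' X) = X := by
  ext a
  simp [renPreimage_shift]

theorem renPreimage_shift_insert (X : Set ℕ) :
    renPreimage shift (insert 0 (Nat.succ '' X)) = X := by
  ext a
  simp [renPreimage_shift]

theorem exists_shift (σ : PFT) : ∃ σ', List.Forall₂ (RenElt shift) σ σ' := by
  induction σ with
  | nil => exact ⟨[], .nil⟩
  | cons e σ ih =>
    obtain ⟨σ', h⟩ := ih
    rcases e with a | X
    · exact ⟨Sum.inl (a + 1) :: σ', .cons (.act rfl) h⟩
    · refine ⟨Sum.inr (Nat.succ '' X) :: σ', .cons ?_ h⟩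
      have := RenElt.refusal (R := shift) (X := Nat.succ '' X)
      rwa [renPreimage_shift_image] at this

theorem renElt_shift_leftUnique : Relator.LeftUnique (RenElt shift) := by
  rintro _ _ _ (hR | _) h2
  · cases h2 with
    | act hR' => exact congrArg Sum.inl (Nat.succ_injective (hR.symm.trans hR'))
  · cases h2
    rfl

theorem fft_shift_iff {P : Expr} {σ σ' : PFT} (hσ : List.Forall₂ (RenElt shift) σ σ') :
    fft (.ren shift P) σ' ↔ fft P σ := by
  refine ⟨fun h => ?_, fun h => fft_shift h hσ⟩
  obtain ⟨σ₁, h1, -, h3⟩ := fft_ren_decomp h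
  rwa [List.left_unique_forall₂' renElt_shift_leftUnique hσ h3]

theorem not_fft_shift_zero {P : Expr} {X : Set ℕ} {σ : PFT} :
    ¬ fft (.ren shift P) (Sum.inr X :: Sum.inl 0 :: σ) := fun h => by
  obtain ⟨σ₁, -, -, h3⟩ := fft_ren_decomp h
  cases h3 with
  | cons _ h3 =>
    cases h3 with
    | cons he _ =>
      cases he with
      | act hR => simp [shift] at hR

theorem refuses_shift_zero {P : Expr} (hP : stable P) : Refuses (.ren shift P) {0} :=
  refuses_ren.2 ⟨hP, by simp [renPreimage_shift]⟩

/-- The process performing the action `0` and terminating. -/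
def zeroAction : Expr := .pre (.act 0) .nil

theorem isProcess_zeroAction : IsProcess zeroAction :=
  ⟨by rintro x (⟨⟨⟩⟩), .pre .nil⟩

theorem isProcess_timeout_zeroAction : IsProcess (.pre .timeout zeroAction) :=
  ⟨by rintro x (⟨⟨⟨⟩⟩⟩), .pre (.pre .nil)⟩

theorem stable_zeroAction : stable zeroAction := by
  rintro ⟨_, ⟨⟩⟩

theorem refuses_zeroAction {X : Set ℕ} : Refuses zeroAction X ↔ 0 ∉ X := by
  refine ⟨fun h h0 => h.2 0 h0 ⟨_, .pre⟩, fun h => ⟨stable_zeroAction, ?_⟩⟩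
  rintro a ha ⟨_, ⟨⟩⟩
  exact h ha

theorem refuses_timeout_pre {E : Expr} {X : Set ℕ} : Refuses (.pre .timeout E) X :=
  ⟨by rintro ⟨_, ⟨⟩⟩, by rintro a _ ⟨_, ⟨⟩⟩⟩

/-- A stable process is told apart from an unstable one by offering an alternative
that starts with a time-out. -/
theorem fft_shift_choice_timeout_iff {P : Expr} :
    fft (.choice (.ren shift P) (.pre .timeout zeroAction)) [Sum.inr {0}, Sum.inl 0] ↔
      stable P := by
  constructor
  · intro h
    by_contra hP
    obtain ⟨T, hT, hf⟩ := fft_refusal_tau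
      (fun hs => hP (stable_ren.1 (stable_choice.1 hs).1)) h
    cases hT with
    | choiceL hT =>
      cases hT
      exact not_fft_shift_zero hf
    | choiceR hT => cases hT
  · intro hP
    have hr := refuses_choice.2 ⟨refuses_shift_zero hP, refuses_timeout_pre (E := zeroAction)⟩
    exact .timeoutAct hr.2 hr.1 (.choiceR .pre) (.act .pre .top) rfl

theorem stable_shift_choice_zeroAction {P : Expr} :
    stable (.choice (.ren shift P) zeroAction) ↔ stable P := by
  simp [stable_choice, stable_ren, stable_zeroAction]

theorem not_refuses_choice_zeroAction {P : Expr} {X : Set ℕ} (h0 : 0 ∈ X) :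
    ¬ Refuses (.choice P zeroAction) X := fun h =>
  refuses_zeroAction.1 (refuses_choice.1 h).2 h0

theorem rootedLE_of_contexts {P Q : Expr}
    (h : ∀ C : Ctx, Ctx.OK C → fftSet (C.fill Q) ⊆ fftSet (C.fill P)) : RootedLE Q P := by
  have plain : ∀ {σ}, fft Q σ → fft P σ := fun {σ} hσ => h .hole .hole hσ
  have hzero : ∀ {σ}, fft (.choice (.ren shift Q) zeroAction) σ →
      fft (.choice (.ren shift P) zeroAction) σ := fun {σ} hσ =>
    h (.choiceL (.ren shift .hole) zeroAction)
      (.choiceL (.ren shift_finite .hole) isProcess_zeroAction) hσ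
  have hst : stable Q → stable P := fun hQ => fft_shift_choice_timeout_iff.1
    (h (.choiceL (.ren shift .hole) (.pre .timeout zeroAction))
      (.choiceL (.ren shift_finite .hole) isProcess_timeout_zeroAction)
      (fft_shift_choice_timeout_iff.2 hQ))
  refine ⟨plain, hst, ?_, ?_⟩
  · intro X σ Q' hX hs hf
    obtain ⟨σ', hσ'⟩ := exists_shift σ
    have hrel : List.Forall₂ (RenElt shift) (Sum.inr X :: Sum.inr X :: σ)
        (Sum.inr (Nat.succ '' X) :: Sum.inr (insert 0 (Nat.succ '' X)) :: σ') := by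
      have h1 := RenElt.refusal (R := shift) (X := Nat.succ '' X)
      have h2 := RenElt.refusal (R := shift) (X := insert 0 (Nat.succ '' X))
      rw [renPreimage_shift_image] at h1
      rw [renPreimage_shift_insert] at h2
      exact .cons h1 (.cons h2 hσ')
    have hr : Refuses (.choice (.ren shift Q) zeroAction) (Nat.succ '' X) :=
      refuses_choice.2 ⟨refuses_ren.2 (by rwa [renPreimage_shift_image]),
        refuses_zeroAction.2 (by simp)⟩
    have hP : stable (.choice (.ren shift P) zeroAction) :=
      stable_shift_choice_zeroAction.2 (hst hX.1)
    have := hzero (.timeoutRef hr.2 hr.1 (.choiceL (.renTimeout hs))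
      ((fft_shift_iff hrel).2 (fft_refusal_cons subset_rfl hf)))
    cases this with
    | tau hs _ => exact (hP ⟨_, hs⟩).elim
    | refusal _ _ h3 =>
      exact (not_refuses_choice_zeroAction (by simp) (refuses_of_stable hP h3)).elim
    | timeoutRef _ _ hs hf =>
      cases hs with
      | choiceL hs =>
        cases hs with
        | renTimeout hs => exact ⟨_, hs, fft_refusal_dedup ((fft_shift_iff hrel).1 hf)⟩
      | choiceR hs => cases hs
  · intro h0 hP
    by_contra hQ
    have h0' : fft (.ren shift Q) [Sum.inr {0}] := by
      have hr := RenElt.refusal (R := shift) (X := {0})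
      rw [show renPreimage shift {0} = ∅ by simp [renPreimage_shift]] at hr
      exact (fft_shift_iff (.cons hr .nil)).2 h0
    exact not_refuses_choice_zeroAction (Set.mem_singleton 0) (refuses_of_stable
      (stable_shift_choice_zeroAction.2 hP)
      (hzero (fft_choice_of_unstable (fun hs => hQ (stable_ren.1 hs)) h0')))

/-- The rooted partial failure trace preorder is the largest
precongruence for the operators of CCSP_t included in the partial failure trace
preorder: `rfft(P) ⊇ rfft(Q)` iff `fft(C[P]) ⊇ fft(C[Q])` for every unary
recursion-free CCSP_t-context `C`. -/
theorem rfft_full_abstraction_preorder (P Q : Expr)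
    (hP : IsProcess P) (hQ : IsProcess Q) :
    rfftSet Q ⊆ rfftSet P ↔
      ∀ C : Ctx, Ctx.OK C → fftSet (C.fill Q) ⊆ fftSet (C.fill P) := by
  rw [rfftSet_subset_iff]
  exact ⟨fun h C _ _ hσ => (h.fill C).plain hσ, rootedLE_of_contexts⟩
end

section
/- May testing characterises the converse of the partial failure trace preorder: for all processes P and Q in which the distinguished success action ω is fresh, P ⊑_may Q if and only if fft(Q) ⊇ fft(P). -/
/-! ### Safety and freshness -/

/-- Reachability via the transition relation. -/
inductive Reach : Expr → Expr → Prop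
  | refl (P) : Reach P P
  | step {P α Q R} : Step P α Q → Reach Q R → Reach P R

/-- The action `b` is fresh for the process `P`: no process reachable from `P`
has an outgoing `b`-transition. -/
def FreshFor (b : ℕ) (P : Expr) : Prop :=
  ∀ R, Reach P R → ∀ R', ¬ Step R (.act b) R'

/-- The action `b` is fresh for the partial failure trace `σ`: it occurs in `σ`
neither as an action nor inside a refusal set. -/
def FreshTrace (b : ℕ) (σ : PFT) : Prop :=
  Sum.inl b ∉ σ ∧ ∀ X : Set ℕ, Sum.inr X ∈ σ → b ∉ X

/-- The canonical safety property: `P ⊨ safety(b)` iff no partial failure trace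
of `P` contains the action `b`. -/
def Safety (b : ℕ) (P : Expr) : Prop := ∀ σ, fft P σ → Sum.inl b ∉ σ

/-- `P` may pass the test `T`: `τ_{A∖{ω}}(T ∥_{A∖{ω}} P)` has a partial failure
trace containing the success action `ω`. -/
def MayPass (ω : ℕ) (T P : Expr) : Prop :=
  ∃ σ, fft (.abs {a | a ≠ ω} (.par {a | a ≠ ω} T P)) σ ∧ Sum.inl ω ∈ σ

/-! ### Freshness and reachability -/

theorem FreshFor.of_step {b : ℕ} {P P' : Expr} {α : Act} (h : FreshFor b P)
    (hs : Step P α P') : FreshFor b P' :=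
  fun R hR => h R (.step hs hR)

theorem FreshFor.not_step {b : ℕ} {P P' : Expr} (h : FreshFor b P) :
    ¬ Step P (.act b) P' :=
  h P (.refl P) P'

theorem FreshFor.notMem_initials {b : ℕ} {P : Expr} (h : FreshFor b P) :
    b ∉ initials P :=
  fun ⟨_, hs⟩ => h.not_step hs

theorem FreshFor.safety {b : ℕ} {P : Expr} (h : FreshFor b P) : Safety b P := by
  intro σ hσ
  induction hσ with
  | top => simp
  | act hs _ ih =>
    have := ih (h.of_step hs)
    simp only [List.mem_cons, Sum.inl.injEq, not_or]
    refine ⟨?_, this⟩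
    rintro rfl
    exact h.not_step hs
  | tau hs _ ih => exact ih (h.of_step hs)
  | refusal _ _ _ ih => simpa using ih h
  | timeoutRef _ _ hs _ ih => exact ih (h.of_step hs)
  | timeoutAct _ _ hs _ _ ih => simpa using ih (h.of_step hs)

theorem mem_initials_of_fft {P : Expr} {a : ℕ} {ρ : PFT} (hst : stable P)
    (h : fft P (Sum.inl a :: ρ)) : a ∈ initials P := by
  cases h with
  | act hs _ => exact ⟨_, hs⟩
  | tau hs _ => exact absurd ⟨_, hs⟩ hst

/-! ### Passing a test, in terms of the transitions of the test and of the process -/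

/-- The composition of the test `T` with `P` is stable. -/
def JointlyStable (ω : ℕ) (T P : Expr) : Prop :=
  stable T ∧ stable P ∧ ∀ a, a ≠ ω → a ∈ initials T → a ∉ initials P

/-- The composition of the test `T` with `P` reaches a state in which the test reports
success, with time-outs occurring in stable states only. -/
inductive Pass (ω : ℕ) : Expr → Expr → Prop
  | success {T T' P} : Step T (.act ω) T' → Pass ω T P
  | tauL {T T' P} : Step T .tau T' → Pass ω T' P → Pass ω T P
  | tauR {T P P'} : Step P .tau P' → Pass ω T P' → Pass ω T P
  | sync {T T' P P' a} : a ≠ ω → Step T (.act a) T' → Step P (.act a) P' →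
      Pass ω T' P' → Pass ω T P
  | timeoutL {T T' P} : JointlyStable ω T P → Step T .timeout T' → Pass ω T' P →
      Pass ω T P
  | timeoutR {T P P'} : JointlyStable ω T P → Step P .timeout P' → Pass ω T P' →
      Pass ω T P

/-- The test `T` applied to `P`. -/
def applyTest (ω : ℕ) (T P : Expr) : Expr :=
  .abs {a | a ≠ ω} (.par {a | a ≠ ω} T P)

theorem step_applyTest_iff {ω : ℕ} {T P E : Expr} {α : Act} :
    Step (applyTest ω T P) α E ↔ ∃ T' P', E = applyTest ω T' P' ∧
      ((α.notIn {a | a ≠ ω} ∧ Step T α T' ∧ P' = P) ∨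
       (α.notIn {a | a ≠ ω} ∧ Step P α P' ∧ T' = T) ∨
       (α = .tau ∧ ∃ a, a ≠ ω ∧ Step T (.act a) T' ∧ Step P (.act a) P')) := by
  constructor
  · intro h
    unfold applyTest at h
    cases h with
    | absFree h hn =>
      cases h with
      | parL h _ => exact ⟨_, _, rfl, .inl ⟨hn, h, rfl⟩⟩
      | parR h _ => exact ⟨_, _, rfl, .inr (.inl ⟨hn, h, rfl⟩)⟩
      | parSync _ _ ha => exact absurd ha (hn _ rfl)
    | absHide h ha =>
      cases h with
      | parL _ hn => exact absurd ha (hn _ rfl)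
      | parR _ hn => exact absurd ha (hn _ rfl)
      | parSync h₁ h₂ ha => exact ⟨_, _, rfl, .inr (.inr ⟨rfl, _, ha, h₁, h₂⟩)⟩
  · rintro ⟨T', P', rfl, ⟨hn, h, rfl⟩ | ⟨hn, h, rfl⟩ | ⟨rfl, a, ha, h₁, h₂⟩⟩
    · exact .absFree (.parL h hn) hn
    · exact .absFree (.parR h hn) hn
    · exact .absHide (.parSync h₁ h₂ ha) ha

theorem stable_applyTest_iff {ω : ℕ} {T P : Expr} :
    stable (applyTest ω T P) ↔ JointlyStable ω T P := by
  have ht : Act.tau.notIn {a | a ≠ ω} := by intro a h; cases h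
  constructor
  · intro h
    refine ⟨fun ⟨T', hs⟩ => h ⟨_, step_applyTest_iff.2 ⟨_, _, rfl, .inl ⟨ht, hs, rfl⟩⟩⟩,
      fun ⟨P', hs⟩ => h ⟨_, step_applyTest_iff.2 ⟨_, _, rfl, .inr (.inl ⟨ht, hs, rfl⟩)⟩⟩, ?_⟩
    rintro a ha ⟨T', h₁⟩ ⟨P', h₂⟩
    exact h ⟨_, step_applyTest_iff.2 ⟨_, _, rfl, .inr (.inr ⟨rfl, a, ha, h₁, h₂⟩)⟩⟩
  · rintro ⟨hT, hP, hI⟩ ⟨E, hE⟩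
    obtain ⟨T', P', rfl, ⟨_, hs, _⟩ | ⟨_, hs, _⟩ | ⟨_, a, ha, h₁, h₂⟩⟩ :=
      step_applyTest_iff.1 hE
    · exact hT ⟨_, hs⟩
    · exact hP ⟨_, hs⟩
    · exact hI a ha ⟨_, h₁⟩ ⟨_, h₂⟩

theorem fft_applyTest_timeout {ω : ℕ} {E F : Expr} (hst : stable E)
    (hs : Step E .timeout F)
    (h : fft F [.inl ω] ∨ fft F [.inr {ω}, .inl ω]) :
    fft E [.inl ω] ∨ fft E [.inr {ω}, .inl ω] := by
  by_cases hω : ω ∈ initials E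
  · obtain ⟨E', hE'⟩ := hω
    exact .inl (.act hE' .top)
  · have hr : ∀ a ∈ ({ω} : Set ℕ), a ∉ initials E := by
      rintro a rfl
      exact hω
    rcases h with h | h
    · exact .inr (.timeoutAct hr hst hs h rfl)
    · exact .inr (.timeoutRef hr hst hs h)

theorem Pass.fft_applyTest {ω : ℕ} {T P : Expr} (h : Pass ω T P) :
    fft (applyTest ω T P) [.inl ω] ∨ fft (applyTest ω T P) [.inr {ω}, .inl ω] := by
  have ht : Act.tau.notIn {a | a ≠ ω} := by intro a h; cases h
  have hto : Act.timeout.notIn {a | a ≠ ω} := by intro a h; cases h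
  induction h with
  | success hs =>
    refine .inl (.act (step_applyTest_iff.2 ⟨_, _, rfl, .inl ⟨?_, hs, rfl⟩⟩) .top)
    rintro a h ha
    cases h
    exact ha rfl
  | @tauL T T' P hs _ ih =>
    have : Step (applyTest ω T P) .tau (applyTest ω T' P) :=
      step_applyTest_iff.2 ⟨_, _, rfl, .inl ⟨ht, hs, rfl⟩⟩
    exact ih.imp (.tau this) (.tau this)
  | @tauR T P P' hs _ ih =>
    have : Step (applyTest ω T P) .tau (applyTest ω T P') :=
      step_applyTest_iff.2 ⟨_, _, rfl, .inr (.inl ⟨ht, hs, rfl⟩)⟩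
    exact ih.imp (.tau this) (.tau this)
  | sync ha h₁ h₂ _ ih =>
    have := step_applyTest_iff.2 ⟨_, _, rfl, .inr (.inr ⟨rfl, _, ha, h₁, h₂⟩)⟩
    exact ih.imp (.tau this) (.tau this)
  | timeoutL hst hs _ ih =>
    exact fft_applyTest_timeout (stable_applyTest_iff.2 hst)
      (step_applyTest_iff.2 ⟨_, _, rfl, .inl ⟨hto, hs, rfl⟩⟩) ih
  | timeoutR hst hs _ ih =>
    exact fft_applyTest_timeout (stable_applyTest_iff.2 hst)
      (step_applyTest_iff.2 ⟨_, _, rfl, .inr (.inl ⟨hto, hs, rfl⟩)⟩) ih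

theorem pass_of_step_timeout {ω : ℕ} {T P F : Expr} (hP : FreshFor ω P)
    (hst : stable (applyTest ω T P)) (hs : Step (applyTest ω T P) .timeout F)
    (ih : ∀ T' P', FreshFor ω P' → F = applyTest ω T' P' → Pass ω T' P') :
    Pass ω T P := by
  obtain ⟨T', P', rfl, ⟨_, h, rfl⟩ | ⟨_, h, rfl⟩ | ⟨h, _⟩⟩ := step_applyTest_iff.1 hs
  · exact .timeoutL (stable_applyTest_iff.1 hst) h (ih _ _ hP rfl)
  · exact .timeoutR (stable_applyTest_iff.1 hst) h (ih _ _ (hP.of_step h) rfl)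
  · cases h

theorem pass_of_fft_applyTest {ω : ℕ} {E : Expr} {σ : PFT} (h : fft E σ)
    (hω : Sum.inl ω ∈ σ) :
    ∀ T P, FreshFor ω P → E = applyTest ω T P → Pass ω T P := by
  induction h with
  | top => simp at hω
  | @act _ _ a _ hs _ _ =>
    rintro T P hP rfl
    obtain ⟨T', P', rfl, ⟨hn, h, rfl⟩ | ⟨hn, h, rfl⟩ | ⟨h, _⟩⟩ := step_applyTest_iff.1 hs
    · obtain rfl : a = ω := not_not.1 (hn a rfl)
      exact .success h
    · obtain rfl : a = ω := not_not.1 (hn a rfl)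
      exact absurd h hP.not_step
    · cases h
  | tau hs _ ih =>
    rintro T P hP rfl
    obtain ⟨T', P', rfl, ⟨_, h, rfl⟩ | ⟨_, h, rfl⟩ | ⟨_, a, ha, h₁, h₂⟩⟩ :=
      step_applyTest_iff.1 hs
    · exact .tauL h (ih hω _ _ hP rfl)
    · exact .tauR h (ih hω _ _ (hP.of_step h) rfl)
    · exact .sync ha h₁ h₂ (ih hω _ _ (hP.of_step h₂) rfl)
  | refusal _ _ _ ih => exact ih (by simpa using hω)
  | timeoutRef _ hst hs _ ih =>
    rintro T P hP rfl
    exact pass_of_step_timeout hP hst hs (ih hω)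
  | timeoutAct _ hst hs _ _ ih =>
    rintro T P hP rfl
    exact pass_of_step_timeout hP hst hs (ih (by simpa using hω))

theorem mayPass_iff_pass {ω : ℕ} {T P : Expr} (hP : FreshFor ω P) :
    MayPass ω T P ↔ Pass ω T P := by
  constructor
  · rintro ⟨σ, hσ, hω⟩
    exact pass_of_fft_applyTest hσ hω T P hP rfl
  · intro h
    rcases h.fft_applyTest with h | h
    · exact ⟨_, h, by simp⟩
    · exact ⟨_, h, by simp⟩

/-! ### Passing a test depends on the partial failure traces only -/

/-- The test `T` succeeds against every process with the partial failure trace `σ`. -/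
inductive Compat (ω : ℕ) : Expr → PFT → Prop
  | success {T T'} : Step T (.act ω) T' → Compat ω T []
  | tau {T T' σ} : Step T .tau T' → Compat ω T' σ → Compat ω T σ
  | act {T T' a σ} : a ≠ ω → Step T (.act a) T' → Compat ω T' σ →
      Compat ω T (.inl a :: σ)
  | idle {T X σ} : stable T → (∀ a, a ≠ ω → (a ∈ X ↔ a ∈ initials T)) →
      Compat ω T σ → Compat ω T (.inr X :: σ)
  | timeout {T T' X σ} : stable T → (∀ a, a ≠ ω → (a ∈ X ↔ a ∈ initials T)) →
      (∀ a ρ, σ = .inl a :: ρ → a ∉ X) → Step T .timeout T' → Compat ω T' σ →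
      Compat ω T (.inr X :: σ)

theorem Pass.exists_compat {ω : ℕ} {T P : Expr} (h : Pass ω T P) (hP : FreshFor ω P) :
    ∃ σ, fft P σ ∧ Compat ω T σ := by
  induction h with
  | success hs => exact ⟨[], .top, .success hs⟩
  | tauL hs _ ih =>
    obtain ⟨σ, h₁, h₂⟩ := ih hP
    exact ⟨σ, h₁, .tau hs h₂⟩
  | tauR hs _ ih =>
    obtain ⟨σ, h₁, h₂⟩ := ih (hP.of_step hs)
    exact ⟨σ, .tau hs h₁, h₂⟩
  | sync ha hT hs _ ih =>
    obtain ⟨σ, h₁, h₂⟩ := ih (hP.of_step hs)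
    exact ⟨_, .act hs h₁, .act ha hT h₂⟩
  | @timeoutL T T' P hst hs _ ih =>
    obtain ⟨σ, h₁, h₂⟩ := ih hP
    have hr : ∀ a ∈ {a | a ≠ ω ∧ a ∈ initials T}, a ∉ initials P :=
      fun a ha => hst.2.2 a ha.1 ha.2
    refine ⟨_, .refusal hr hst.2.1 h₁,
      .timeout hst.1 (fun a ha => ⟨And.right, And.intro ha⟩) ?_ hs h₂⟩
    rintro a ρ rfl ha
    exact hr a ha (mem_initials_of_fft hst.2.1 h₁)
  | @timeoutR T P P' hst hs _ ih =>
    obtain ⟨σ, h₁, h₂⟩ := ih (hP.of_step hs)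
    have hr : ∀ X : Set ℕ, (∀ a, a ≠ ω → (a ∈ X ↔ a ∈ initials T)) →
        ∀ a ∈ X, a ∉ initials P := by
      intro X hX a ha
      by_cases haω : a = ω
      · exact haω ▸ hP.notMem_initials
      · exact hst.2.2 a haω ((hX a haω).1 ha)
    cases h₂ with
    | success hω => exact ⟨[], .top, .success hω⟩
    | tau hτ _ => exact absurd ⟨_, hτ⟩ hst.1
    | act ha hT hc =>
      have hX : ∀ a, a ≠ ω → (a ∈ {a | a ≠ ω ∧ a ∈ initials T} ↔ a ∈ initials T) :=
        fun a ha => ⟨And.right, And.intro ha⟩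
      exact ⟨_, .timeoutAct (hr _ hX) hst.2.1 hs h₁ ⟨ha, _, hT⟩,
        .idle hst.1 hX (.act ha hT hc)⟩
    | idle hT hX hc => exact ⟨_, .timeoutRef (hr _ hX) hst.2.1 hs h₁, .idle hT hX hc⟩
    | timeout hT hX hn ht hc =>
      exact ⟨_, .timeoutRef (hr _ hX) hst.2.1 hs h₁, .timeout hT hX hn ht hc⟩

theorem Compat.pass {ω : ℕ} {T : Expr} {σ : PFT} (h : Compat ω T σ) :
    ∀ {Q : Expr}, fft Q σ → Pass ω T Q := by
  induction h with
  | success hs => exact fun _ => .success hs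
  | tau hs _ ih => exact fun hQ => .tauL hs (ih hQ)
  | @act T T' a σ ha hs _ ih =>
    intro Q hQ
    generalize hρ : (Sum.inl a :: σ : PFT) = ρ at hQ
    induction hQ with
    | act hs' hQ' _ =>
      cases hρ
      exact .sync ha hs hs' (ih hQ')
    | tau hs' _ ih' => exact .tauR hs' (ih' hρ)
    | _ => cases hρ
  | @idle T X σ hT hX _ ih =>
    intro Q hQ
    generalize hρ : (Sum.inr X :: σ : PFT) = ρ at hQ
    induction hQ with
    | tau hs' _ ih' => exact .tauR hs' (ih' hρ)
    | refusal hr hst hQ' _ =>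
      cases hρ
      exact ih hQ'
    | timeoutRef hr hst hs' hQ' ih' =>
      cases hρ
      exact .timeoutR ⟨hT, hst, fun a ha h => hr a ((hX a ha).2 h)⟩ hs' (ih' rfl)
    | timeoutAct hr hst hs' hQ' _ _ =>
      cases hρ
      exact .timeoutR ⟨hT, hst, fun a ha h => hr a ((hX a ha).2 h)⟩ hs' (ih hQ')
    | _ => cases hρ
  | @timeout T T' X σ hT hX hn ht _ ih =>
    intro Q hQ
    generalize hρ : (Sum.inr X :: σ : PFT) = ρ at hQ
    induction hQ with
    | tau hs' _ ih' => exact .tauR hs' (ih' hρ)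
    | refusal hr hst hQ' _ =>
      cases hρ
      exact .timeoutL ⟨hT, hst, fun a ha h => hr a ((hX a ha).2 h)⟩ ht (ih hQ')
    | timeoutRef hr hst hs' hQ' ih' =>
      cases hρ
      exact .timeoutR ⟨hT, hst, fun a ha h => hr a ((hX a ha).2 h)⟩ hs' (ih' rfl)
    | timeoutAct _ _ _ _ ha _ =>
      cases hρ
      exact absurd ha (hn _ _ rfl)
    | _ => cases hρ

/-! ### Infinite choice by unguarded recursion -/

open Classical in
/-- The equations `Xₙ = n.0 + Xₙ₊₁` for `n ∈ S` and `Xₙ = Xₙ₊₁` for `n ∉ S`. -/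
noncomputable def menuSpec (S : Set ℕ) : ℕ → Option Expr := fun n =>
  some (if n ∈ S then .choice (.pre (.act n) .nil) (.var (n + 1)) else .var (n + 1))

/-- A process offering exactly the actions in `S`, each of them followed by `0`. -/
noncomputable def menu (S : Set ℕ) : Expr := .fix 0 (menuSpec S)

theorem isProcess_menu (S : Set ℕ) : IsProcess (menu S) := by
  constructor
  · intro x h
    cases h with
    | fix _ _ h => simp [menuSpec] at h
  · refine .fix rfl fun n E h => ?_
    cases h
    split_ifs
    · exact .choice (.pre .nil) .var
    · exact .var

theorem step_fix_menuSpec_succ {S : Set ℕ} {n : ℕ} {α : Act} {E : Expr}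
    (h : Step (.fix (n + 1) (menuSpec S)) α E) : Step (.fix n (menuSpec S)) α E := by
  have hv : Subst (recmap (menuSpec S)) (.var (n + 1)) (.fix (n + 1) (menuSpec S)) :=
    .varSome rfl
  by_cases hn : n ∈ S
  · exact .fixUnfold (by simp only [menuSpec, if_pos hn]; rfl)
      (.choice (.pre .nil) hv) (.choiceR h)
  · exact .fixUnfold (by simp only [menuSpec, if_neg hn]) hv h

theorem step_menu {S : Set ℕ} {b : ℕ} (hb : b ∈ S) : Step (menu S) (.act b) .nil := by
  have h₀ : Step (.fix b (menuSpec S)) (.act b) .nil :=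
    .fixUnfold (by simp only [menuSpec, if_pos hb]; rfl)
      (.choice (.pre .nil) (.varSome rfl)) (.choiceL .pre)
  have h : ∀ m n, m + n = b → Step (.fix m (menuSpec S)) (.act b) .nil := by
    intro m n
    induction n generalizing m with
    | zero =>
      rintro rfl
      exact h₀
    | succ n ih => exact fun h => step_fix_menuSpec_succ (ih (m + 1) (by omega))
  exact h 0 b (by omega)

theorem subst_var_menuSpec {S : Set ℕ} {n : ℕ} {E : Expr}
    (h : Subst (recmap (menuSpec S)) (.var n) E) : E = .fix n (menuSpec S) := by
  cases h with
  | varNone h => cases h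
  | varSome h =>
    cases h
    rfl

theorem step_fix_menuSpec {S : Set ℕ} {F E : Expr} {α : Act} (h : Step F α E) :
    ∀ n, (F = .fix n (menuSpec S) ∨
        F = .choice (.pre (.act n) .nil) (.fix (n + 1) (menuSpec S)) ∧ n ∈ S ∨
        F = .pre (.act n) .nil ∧ n ∈ S) →
      ∃ b ∈ S, α = .act b ∧ E = .nil := by
  induction h with
  | pre =>
    rintro n (h | ⟨h, _⟩ | ⟨h, hn⟩) <;> cases h
    exact ⟨n, hn, rfl, rfl⟩
  | choiceL _ ih =>
    rintro n (h | ⟨h, hn⟩ | ⟨h, _⟩) <;> cases h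
    exact ih n (.inr (.inr ⟨rfl, hn⟩))
  | choiceR _ ih =>
    rintro n (h | ⟨h, _⟩ | ⟨h, _⟩) <;> cases h
    exact ih (n + 1) (.inl rfl)
  | @fixUnfold n _ _ _ _ _ hE hsub _ ih =>
    rintro _ (h | ⟨h, _⟩ | ⟨h, _⟩) <;> cases h
    cases hE
    split_ifs at hsub with hn
    · cases hsub with
      | choice h₁ h₂ =>
        cases h₁ with
        | pre h₁ =>
          cases h₁
          exact ih n (.inr (.inl ⟨by rw [subst_var_menuSpec h₂], hn⟩))
    · exact ih (n + 1) (.inl (subst_var_menuSpec hsub))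
  | _ => rintro n (h | ⟨h, _⟩ | ⟨h, _⟩) <;> cases h

theorem step_menu_iff {S : Set ℕ} {α : Act} {E : Expr} :
    Step (menu S) α E ↔ ∃ b ∈ S, α = .act b ∧ E = .nil := by
  constructor
  · exact fun h => step_fix_menuSpec h 0 (.inl rfl)
  · rintro ⟨b, hb, rfl, rfl⟩
    exact step_menu hb

/-! ### The test of a partial failure trace -/

theorem isProcess_nil : IsProcess .nil := by
  refine ⟨fun x h => ?_, .nil⟩
  cases h

theorem IsProcess.pre {α : Act} {E : Expr} (h : IsProcess E) : IsProcess (.pre α E) := by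
  refine ⟨fun x hx => ?_, .pre h.2⟩
  cases hx with
  | pre hx => exact h.1 x hx

theorem IsProcess.choice {E F : Expr} (hE : IsProcess E) (hF : IsProcess F) :
    IsProcess (.choice E F) := by
  refine ⟨fun x hx => ?_, .choice hE.2 hF.2⟩
  cases hx with
  | choiceL hx => exact hE.1 x hx
  | choiceR hx => exact hF.1 x hx

theorem step_pre_iff {α β : Act} {E F : Expr} :
    Step (.pre α E) β F ↔ β = α ∧ F = E := by
  constructor
  · intro h
    cases h
    exact ⟨rfl, rfl⟩
  · rintro ⟨rfl, rfl⟩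
    exact .pre

theorem step_choice_iff {α : Act} {E F G : Expr} :
    Step (.choice E F) α G ↔ Step E α G ∨ Step F α G := by
  constructor
  · intro h
    cases h with
    | choiceL h => exact .inl h
    | choiceR h => exact .inr h
  · exact fun h => h.elim .choiceL .choiceR

open Classical in
/-- The test for the partial failure trace `σ`, to be run right after a refusal of `X`. -/
noncomputable def traceTest (ω : ℕ) : Set ℕ → PFT → Expr
  | _, [] => .pre (.act ω) .nil
  | X, .inl a :: σ =>
    .choice (if a ∈ X then menu {b | b ∈ X ∧ b ≠ ω ∧ b ≠ a} else .pre .tau .nil)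
      (.pre (.act a) (traceTest ω ∅ σ))
  | _, .inr Y :: σ => .choice (menu {b | b ∈ Y ∧ b ≠ ω}) (.pre .timeout (traceTest ω Y σ))

theorem isProcess_traceTest (ω : ℕ) (X : Set ℕ) (σ : PFT) :
    IsProcess (traceTest ω X σ) := by
  induction σ generalizing X with
  | nil => exact isProcess_nil.pre
  | cons e σ ih =>
    cases e with
    | inl a =>
      refine IsProcess.choice ?_ (ih ∅).pre
      split_ifs
      · exact isProcess_menu _
      · exact isProcess_nil.pre
    | inr Y => exact (isProcess_menu _).choice (ih Y).pre

theorem step_traceTest_act_of_mem {ω a : ℕ} {X : Set ℕ} {σ : PFT} {α : Act} {E : Expr}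
    (ha : a ∈ X) :
    Step (traceTest ω X (.inl a :: σ)) α E ↔
      (∃ b, (b ∈ X ∧ b ≠ ω ∧ b ≠ a) ∧ α = .act b ∧ E = .nil) ∨
      (α = .act a ∧ E = traceTest ω ∅ σ) := by
  simp only [traceTest, if_pos ha, step_choice_iff, step_pre_iff, step_menu_iff,
    Set.mem_ofPred_eq]

theorem step_traceTest_act_of_notMem {ω a : ℕ} {X : Set ℕ} {σ : PFT} {α : Act} {E : Expr}
    (ha : a ∉ X) :
    Step (traceTest ω X (.inl a :: σ)) α E ↔
      (α = .tau ∧ E = .nil) ∨ (α = .act a ∧ E = traceTest ω ∅ σ) := by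
  simp [traceTest, step_choice_iff, step_pre_iff, ha]

theorem step_traceTest_refusal {ω : ℕ} {X Y : Set ℕ} {σ : PFT} {α : Act} {E : Expr} :
    Step (traceTest ω X (.inr Y :: σ)) α E ↔
      (∃ b, (b ∈ Y ∧ b ≠ ω) ∧ α = .act b ∧ E = .nil) ∨
      (α = .timeout ∧ E = traceTest ω Y σ) := by
  simp [traceTest, step_choice_iff, step_pre_iff, step_menu_iff]

theorem jointlyStable_traceTest_refusal {ω : ℕ} {X Y : Set ℕ} {σ : PFT} {P : Expr}
    (hst : stable P) (hr : ∀ a ∈ Y, a ∉ initials P) :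
    JointlyStable ω (traceTest ω X (.inr Y :: σ)) P := by
  refine ⟨?_, hst, ?_⟩
  · rintro ⟨E, h⟩
    simp [step_traceTest_refusal] at h
  · rintro a - ⟨E, h⟩
    obtain ⟨b, hb, h, -⟩ | ⟨h, -⟩ := step_traceTest_refusal.1 h
    · cases h
      exact hr a hb.1
    · cases h

theorem jointlyStable_traceTest_act {ω a : ℕ} {X : Set ℕ} {σ : PFT} {P : Expr}
    (ha : a ∈ X) (hst : stable P) (hr : ∀ a ∈ X, a ∉ initials P) :
    JointlyStable ω (traceTest ω X (.inl a :: σ)) P := by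
  refine ⟨?_, hst, ?_⟩
  · rintro ⟨E, h⟩
    simp [step_traceTest_act_of_mem ha] at h
  · rintro b - ⟨E, h⟩
    obtain ⟨c, hc, h, -⟩ | ⟨h, -⟩ := (step_traceTest_act_of_mem ha).1 h
    · cases h
      exact hr b hc.1
    · cases h
      exact hr _ ha

theorem pass_traceTest_of_fft {ω : ℕ} {P : Expr} {σ : PFT} (h : fft P σ)
    (hω : Sum.inl ω ∉ σ) (X : Set ℕ) : Pass ω (traceTest ω X σ) P := by
  induction h generalizing X with
  | top => exact .success .pre
  | @act _ _ a _ hs _ ih =>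
    simp only [List.mem_cons, Sum.inl.injEq, not_or] at hω
    exact .sync (Ne.symm hω.1) (.choiceR .pre) hs (ih hω.2 ∅)
  | tau hs _ ih => exact .tauR hs (ih hω X)
  | refusal hr hst _ ih =>
    exact .timeoutL (jointlyStable_traceTest_refusal hst hr) (.choiceR .pre)
      (ih (by simpa using hω) _)
  | timeoutRef hr hst hs _ ih =>
    exact .timeoutR (jointlyStable_traceTest_refusal hst hr) hs (ih hω X)
  | timeoutAct hr hst hs _ ha ih =>
    exact .timeoutL (jointlyStable_traceTest_refusal hst hr) (.choiceR .pre)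
      (.timeoutR (jointlyStable_traceTest_act ha hst hr) hs (ih (by simpa using hω) _))

theorem not_step_nil {α : Act} {E : Expr} : ¬ Step .nil α E := by
  intro h
  cases h

theorem not_pass_nil {ω : ℕ} {Q : Expr} : ¬ Pass ω .nil Q := by
  intro h
  generalize hT : Expr.nil = T at h
  induction h with
  | tauR _ _ ih => exact ih hT
  | timeoutR _ _ _ ih => exact ih hT
  | _ =>
    subst hT
    exact not_step_nil ‹_›

theorem fft_of_pass_traceTest {ω : ℕ} {σ : PFT} (hω : Sum.inl ω ∉ σ) {X : Set ℕ}
    {Q : Expr} (hQ : FreshFor ω Q) (h : Pass ω (traceTest ω X σ) Q) :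
    fft Q σ ∨ ∃ a ρ, σ = .inl a :: ρ ∧ a ∈ X ∧ fft Q (.inr X :: σ) := by
  induction σ generalizing X Q with
  | nil => exact .inl .top
  | cons e σ ih =>
    have ih' := @ih (fun h => hω (List.mem_cons_of_mem _ h))
    cases e with
    | inl a =>
      have haω : a ≠ ω := by
        rintro rfl
        simp at hω
      by_cases ha : a ∈ X
      · suffices fft Q (.inl a :: σ) ∨ fft Q (.inr X :: .inl a :: σ) from
          this.imp id fun h => ⟨a, σ, rfl, ha, h⟩
        generalize hT : traceTest ω X (.inl a :: σ) = T at h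
        induction h with
        | success hs =>
          subst hT
          obtain ⟨b, hb, h, -⟩ | ⟨h, -⟩ := (step_traceTest_act_of_mem ha).1 hs
          · cases h
            exact absurd rfl hb.2.1
          · cases h
            exact absurd rfl haω
        | tauL hs =>
          subst hT
          simp [step_traceTest_act_of_mem ha] at hs
        | tauR hs _ ihp => exact (ihp (hQ.of_step hs) hT).imp (.tau hs) (.tau hs)
        | sync _ hT' hs hp =>
          subst hT
          obtain ⟨b, -, -, rfl⟩ | ⟨h, rfl⟩ := (step_traceTest_act_of_mem ha).1 hT'
          · exact absurd hp not_pass_nil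
          · cases h
            obtain h | ⟨_, _, _, h, _⟩ := ih' (hQ.of_step hs) hp
            · exact .inl (.act hs h)
            · cases h
        | timeoutL _ hs =>
          subst hT
          simp [step_traceTest_act_of_mem ha] at hs
        | @timeoutR _ P _ hst hs _ ihp =>
          have hr : ∀ b ∈ X, b ∉ initials P := by
            intro b hb
            by_cases hbω : b = ω
            · exact hbω ▸ hQ.notMem_initials
            · refine hst.2.2 b hbω ?_
              subst hT
              by_cases hba : b = a
              · exact ⟨_, (step_traceTest_act_of_mem ha).2 (.inr ⟨by rw [hba], rfl⟩)⟩
              · exact ⟨_, (step_traceTest_act_of_mem ha).2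
                  (.inl ⟨b, ⟨hb, hbω, hba⟩, rfl, rfl⟩)⟩
          refine .inr ?_
          rcases ihp (hQ.of_step hs) hT with h | h
          · exact .timeoutAct hr hst.2.1 hs h ha
          · exact .timeoutRef hr hst.2.1 hs h
      · left
        generalize hT : traceTest ω X (.inl a :: σ) = T at h
        induction h with
        | success hs =>
          subst hT
          obtain ⟨h, -⟩ | ⟨h, -⟩ := (step_traceTest_act_of_notMem ha).1 hs
          · cases h
          · cases h
            exact absurd rfl haω
        | tauL hs hp =>
          subst hT
          obtain ⟨-, rfl⟩ | ⟨h, -⟩ := (step_traceTest_act_of_notMem ha).1 hs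
          · exact absurd hp not_pass_nil
          · cases h
        | tauR hs _ ihp => exact .tau hs (ihp (hQ.of_step hs) hT)
        | sync _ hT' hs hp =>
          subst hT
          obtain ⟨h, -⟩ | ⟨h, rfl⟩ := (step_traceTest_act_of_notMem ha).1 hT'
          · cases h
          · cases h
            obtain h | ⟨_, _, _, h, _⟩ := ih' (hQ.of_step hs) hp
            · exact .act hs h
            · cases h
        | timeoutL hst =>
          subst hT
          exact absurd ⟨_, (step_traceTest_act_of_notMem ha).2 (.inl ⟨rfl, rfl⟩)⟩ hst.1
        | timeoutR hst =>
          subst hT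
          exact absurd ⟨_, (step_traceTest_act_of_notMem ha).2 (.inl ⟨rfl, rfl⟩)⟩ hst.1
    | inr Y =>
      left
      have hr : ∀ {P}, FreshFor ω P → JointlyStable ω (traceTest ω X (.inr Y :: σ)) P →
          ∀ b ∈ Y, b ∉ initials P := by
        intro P hP hst b hb
        by_cases hbω : b = ω
        · exact hbω ▸ hP.notMem_initials
        · exact hst.2.2 b hbω
            ⟨_, step_traceTest_refusal.2 (.inl ⟨b, ⟨hb, hbω⟩, rfl, rfl⟩)⟩
      generalize hT : traceTest ω X (.inr Y :: σ) = T at h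
      induction h with
      | success hs =>
        subst hT
        obtain ⟨b, hb, h, -⟩ | ⟨h, -⟩ := step_traceTest_refusal.1 hs
        · cases h
          exact absurd rfl hb.2
        · cases h
      | tauL hs =>
        subst hT
        simp [step_traceTest_refusal] at hs
      | tauR hs _ ihp => exact .tau hs (ihp (hQ.of_step hs) hT)
      | sync _ hT' _ hp =>
        subst hT
        obtain ⟨b, -, -, rfl⟩ | ⟨h, -⟩ := step_traceTest_refusal.1 hT'
        · exact absurd hp not_pass_nil
        · cases h
      | timeoutL hst hs hp =>
        subst hT
        obtain ⟨b, -, h, -⟩ | ⟨-, rfl⟩ := step_traceTest_refusal.1 hs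
        · cases h
        · obtain h | ⟨_, _, _, _, h⟩ := ih' hQ hp
          · exact .refusal (hr hQ hst) hst.2.1 h
          · exact h
      | timeoutR hst hs _ ihp =>
        subst hT
        exact .timeoutRef (hr hQ hst) hst.2.1 hs (ihp (hQ.of_step hs) rfl)

/-- May testing characterises the converse of the partial
failure trace preorder: for all processes `P` and `Q` in which the distinguished
success action `ω` is fresh, `P ⊑_may Q` if and only if `fft(Q) ⊇ fft(P)`. -/
theorem may_testing (ω : ℕ) (P Q : Expr) (hP : IsProcess P) (hQ : IsProcess Q)
    (hfP : FreshFor ω P) (hfQ : FreshFor ω Q) :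
    (∀ T, IsProcess T → MayPass ω T P → MayPass ω T Q) ↔ fftSet P ⊆ fftSet Q := by
  constructor
  · intro h σ hσ
    have hω := hfP.safety σ hσ
    have := h _ (isProcess_traceTest ω ∅ σ)
      ((mayPass_iff_pass hfP).2 (pass_traceTest_of_fft hσ hω ∅))
    obtain h | ⟨_, _, _, h, _⟩ :=
      fft_of_pass_traceTest hω hfQ ((mayPass_iff_pass hfQ).1 this)
    · exact h
    · cases h
  · intro h T _ hT
    obtain ⟨σ, hσ, hc⟩ := ((mayPass_iff_pass hfP).1 hT).exists_compat hfP
    exact (mayPass_iff_pass hfQ).2 (hc.pass (h hσ))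
end
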